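/- For every p ∈ (1,∞) there exists a separable Banach space U_p admitting an equivalent p-AUS norm such that for every separable Banach space X the following are equivalent: (i) X admits an equivalent p-AUS norm; (ii) X is isomorphic to a closed subspace of U_p; (iii) X is a quotient of U_p (there is a surjective bounded linear map from U_p onto X). -/

import Mathlib

open Metric Set Topology Filter

noncomputable def rhoN (X : Type*) [NormedAddCommGroup X] [NormedSpace ℝ X]
    (N : X → ℝ) (τ : ℝ) : ℝ :=
  letI := Classical.propDecidable (FiniteDimensional ℝ X)
  if FiniteDimensional ℝ X then 0
  else
    sSup { r : ℝ | ∃ y : X, N y ≤ 1 ∧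
      r = sInf { s : ℝ | ∃ E : Submodule ℝ X, IsClosed (E : Set X) ∧
            FiniteDimensional ℝ (X ⧸ E) ∧
            s = sSup { t : ℝ | ∃ x ∈ E, N x ≤ 1 ∧ t = N (y + τ • x) - 1 } } }

noncomputable def rho (X : Type*) [NormedAddCommGroup X] [NormedSpace ℝ X] (τ : ℝ) : ℝ :=
  rhoN X (fun x => ‖x‖) τ

def IsNormFn (X : Type*) [NormedAddCommGroup X] [NormedSpace ℝ X] (N : X → ℝ) : Prop :=
  (∀ x : X, 0 ≤ N x) ∧ (∀ x : X, N x = 0 ↔ x = 0) ∧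
    (∀ (a : ℝ) (x : X), N (a • x) = |a| * N x) ∧ ∀ x y : X, N (x + y) ≤ N x + N y

def IsEquivNorm (X : Type*) [NormedAddCommGroup X] [NormedSpace ℝ X] (N : X → ℝ) : Prop :=
  IsNormFn X N ∧ ∃ a > 0, ∃ b > 0, ∀ x : X, a * ‖x‖ ≤ N x ∧ N x ≤ b * ‖x‖

def IsPAUSNorm (X : Type*) [NormedAddCommGroup X] [NormedSpace ℝ X] (N : X → ℝ) (p : ℝ) : Prop :=
  ∃ C > 0, ∀ τ : ℝ, 0 ≤ τ → rhoN X N τ ≤ C * τ ^ p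

def PAUSable (p : ℝ) (X : Type*) [NormedAddCommGroup X] [NormedSpace ℝ X] : Prop :=
  ∃ N : X → ℝ, IsEquivNorm X N ∧ IsPAUSNorm X N p

def IsomToClosedSubspace (Y U : Type*) [NormedAddCommGroup Y] [NormedSpace ℝ Y]
    [NormedAddCommGroup U] [NormedSpace ℝ U] : Prop :=
  ∃ T : Y →L[ℝ] U, Function.Injective T ∧ ∃ c > 0, ∀ y : Y, c * ‖y‖ ≤ ‖T y‖

def IsQuotientOf (Y U : Type*) [NormedAddCommGroup Y] [NormedSpace ℝ Y]
    [NormedAddCommGroup U] [NormedSpace ℝ U] : Prop :=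
  ∃ Q : U →L[ℝ] Y, Function.Surjective Q


universe u

namespace PAUS

/-- The filter of neighbourhoods of zero for the coarsest topology making all `ev i` continuous. -/
def initialZero {ι V : Type*} (ev : ι → V → ℝ) : Filter V where
  sets := {s | ∃ I : Finset ι, ∃ δ > 0, ∀ z, (∀ i ∈ I, |ev i z| < δ) → z ∈ s}
  univ_sets := ⟨∅, 1, one_pos, fun _ _ => mem_univ _⟩
  sets_of_superset := by
    rintro s t ⟨I, δ, hδ, h⟩ hst
    exact ⟨I, δ, hδ, fun z hz => hst (h z hz)⟩
  inter_sets := by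
    classical
    rintro s t ⟨I, δ, hδ, h⟩ ⟨J, η, hη, k⟩
    refine ⟨I ∪ J, min δ η, lt_min hδ hη, fun z hz => ⟨h z fun i hi => ?_, k z fun i hi => ?_⟩⟩
    · exact (hz i (Finset.mem_union_left _ hi)).trans_le (min_le_left _ _)
    · exact (hz i (Finset.mem_union_right _ hi)).trans_le (min_le_right _ _)

lemma eventually_abs_lt {ι V : Type*} (ev : ι → V → ℝ) (i : ι) {δ : ℝ} (hδ : 0 < δ) :
    ∀ᶠ z in initialZero ev, |ev i z| < δ :=
  ⟨{i}, δ, hδ, fun _ h => h i (Finset.mem_singleton_self i)⟩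

lemma tendsto_initialZero {ι κ V W : Type*} {ev : ι → V → ℝ} {ev' : κ → W → ℝ} {T : V → W}
    (f : κ → ι) (h : ∀ k v, ev' k (T v) = ev (f k) v) :
    Tendsto T (initialZero ev) (initialZero ev') := by
  classical
  rintro s ⟨I, δ, hδ, hs⟩
  refine ⟨I.image f, δ, hδ, fun z hz => hs _ fun i hi => ?_⟩
  rw [h]
  exact hz _ (Finset.mem_image_of_mem f hi)

lemma exists_sub_mem {ι V : Type*} [AddCommGroup V] {ev : ι → V → ℝ}
    (hev : ∀ i v w, ev i (v - w) = ev i v - ev i w) {s : Set V} (hs : s ∈ initialZero ev) :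
    ∃ t ∈ initialZero ev, ∀ v ∈ t, ∀ w ∈ t, v - w ∈ s := by
  obtain ⟨I, δ, hδ, h⟩ := hs
  refine ⟨{z | ∀ i ∈ I, |ev i z| < δ / 2}, ⟨I, δ / 2, by positivity, fun z hz => hz⟩, ?_⟩
  intro v hv w hw
  refine h _ fun i hi => ?_
  rw [hev]
  have := abs_sub (ev i v) (ev i w)
  linarith [hv i hi, hw i hi]

section Weak

variable (X : Type*) [NormedAddCommGroup X] [NormedSpace ℝ X]

/-- Neighbourhoods of zero for the weak topology. -/
def weakZero : Filter X := initialZero fun (f : StrongDual ℝ X) x => f x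

/-- Neighbourhoods of zero for the weak* topology. -/
def weakStarZero : Filter (StrongDual ℝ X) := initialZero fun (x : X) f => f x

variable {X} {Y : Type*} [NormedAddCommGroup Y] [NormedSpace ℝ Y]

lemma tendsto_weakZero (T : X →L[ℝ] Y) : Tendsto T (weakZero X) (weakZero Y) :=
  tendsto_initialZero (fun f => f.comp T) fun _ _ => rfl

lemma tendsto_weakStarZero (T : X →L[ℝ] Y) :
    Tendsto (fun f : StrongDual ℝ Y => f.comp T) (weakStarZero Y) (weakStarZero X) :=
  tendsto_initialZero T fun _ _ => rfl

lemma weakZero_abs_lt (f : StrongDual ℝ X) {δ : ℝ} (hδ : 0 < δ) :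
    ∀ᶠ z in weakZero X, |f z| < δ :=
  eventually_abs_lt (fun (f : StrongDual ℝ X) x => f x) f hδ

lemma weakStarZero_abs_lt (x : X) {δ : ℝ} (hδ : 0 < δ) :
    ∀ᶠ f in weakStarZero X, |f x| < δ :=
  eventually_abs_lt (fun (x : X) (f : StrongDual ℝ X) => f x) x hδ

lemma weakZero_norm_lt [FiniteDimensional ℝ Y] (T : X →L[ℝ] Y) {δ : ℝ} (hδ : 0 < δ) :
    ∀ᶠ z in weakZero X, ‖T z‖ < δ := by
  let b := Module.finBasis ℝ Y
  have hS : 0 < ∑ i, ‖b i‖ + 1 := by positivity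
  have h : ∀ᶠ z in weakZero X, ∀ i, |LinearMap.toContinuousLinearMap (b.coord i) (T z)| <
      δ / (∑ i, ‖b i‖ + 1) := by
    rw [eventually_all]
    exact fun i => weakZero_abs_lt ((LinearMap.toContinuousLinearMap (b.coord i)).comp T)
      (by positivity)
  filter_upwards [h] with z hz
  calc ‖T z‖ = ‖∑ i, b.repr (T z) i • b i‖ := by rw [b.sum_repr]
    _ ≤ ∑ i, ‖b.repr (T z) i • b i‖ := norm_sum_le _ _
    _ ≤ ∑ i, δ / (∑ i, ‖b i‖ + 1) * ‖b i‖ := by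
      refine Finset.sum_le_sum fun i _ => ?_
      rw [norm_smul]
      exact mul_le_mul_of_nonneg_right (hz i).le (norm_nonneg _)
    _ = δ / (∑ i, ‖b i‖ + 1) * ∑ i, ‖b i‖ := by rw [Finset.mul_sum]
    _ < δ / (∑ i, ‖b i‖ + 1) * (∑ i, ‖b i‖ + 1) := by gcongr; linarith
    _ = δ := by field_simp

lemma weakZero_near {E : Submodule ℝ X} (hE : IsClosed (E : Set X)) [FiniteDimensional ℝ (X ⧸ E)]
    {δ : ℝ} (hδ : 0 < δ) : ∀ᶠ z in weakZero X, ∃ e ∈ E, ‖z - e‖ < δ := by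
  have : IsClosed (E : Set X) := hE
  filter_upwards [weakZero_norm_lt E.mkQL hδ] with z hz
  obtain ⟨m, hm, hlt⟩ := Submodule.Quotient.norm_mk_lt (S := E) (E.mkQL z)
    (ε := δ - ‖E.mkQL z‖) (by linarith)
  refine ⟨z - m, ?_, by simpa using hlt⟩
  rw [← Submodule.Quotient.mk_eq_zero, Submodule.Quotient.mk_sub, sub_eq_zero, hm]
  rfl

/-- A ball is covered by finitely many weakly small translates of its points. -/
lemma exists_finite_net (I : Finset (StrongDual ℝ X)) {δ : ℝ} (hδ : 0 < δ) :
    ∃ F : Finset X, (∀ s ∈ F, ‖s‖ ≤ 1) ∧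
      ∀ x : X, ‖x‖ ≤ 1 → ∃ s ∈ F, ∀ φ ∈ I, |φ (x - s)| < δ := by
  let T : X → (I → ℝ) := fun x φ => φ.1 x
  have hTb : TotallyBounded (T '' closedBall 0 1) := by
    refine (isCompact_closedBall (0 : I → ℝ) (∑ φ ∈ I, ‖φ‖)).totallyBounded.subset ?_
    rintro _ ⟨x, hx, rfl⟩
    rw [mem_closedBall_zero_iff] at hx ⊢
    refine (pi_norm_le_iff_of_nonneg (by positivity)).2 fun φ => ?_
    calc ‖φ.1 x‖ ≤ ‖φ.1‖ * ‖x‖ := φ.1.le_opNorm x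
      _ ≤ ‖φ.1‖ := by nlinarith [norm_nonneg φ.1]
      _ ≤ _ := Finset.single_le_sum (f := fun φ : StrongDual ℝ X => ‖φ‖)
        (fun _ _ => norm_nonneg _) φ.2
  obtain ⟨t, hts, htf, ht⟩ := Metric.finite_approx_of_totallyBounded hTb δ hδ
  obtain ⟨F, hF, rfl⟩ := (Set.subset_image_iff.1 hts)
  obtain ⟨F', hF'F, hbij⟩ := (Set.surjOn_image T F).exists_bijOn_subset
  have hfin : F'.Finite := by
    refine Set.Finite.of_finite_image ?_ hbij.injOn
    rw [hbij.image_eq]; exact htf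
  refine ⟨hfin.toFinset, fun s hs => ?_, fun x hx => ?_⟩
  · simpa using hF (hF'F (hfin.mem_toFinset.1 hs))
  · have := ht ⟨x, by simpa using hx, rfl⟩
    simp only [mem_iUnion] at this
    obtain ⟨y, hy, hxy⟩ := this
    obtain ⟨s, hs, rfl⟩ := hbij.surjOn hy
    refine ⟨s, hfin.mem_toFinset.2 hs, fun φ hφ => ?_⟩
    rw [mem_ball, dist_pi_lt_iff hδ] at hxy
    simpa [T, Real.dist_eq] using hxy ⟨φ, hφ⟩

/-- Weak* compactness of the dual ball in terms of the filter `weakStarZero`. -/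
lemma exists_finite_cover (V : StrongDual ℝ X → Set (StrongDual ℝ X))
    (hV : ∀ f, V f ∈ weakStarZero X) :
    ∃ F : Finset (StrongDual ℝ X), (∀ S ∈ F, ‖S‖ ≤ 1) ∧
      ∀ f : StrongDual ℝ X, ‖f‖ ≤ 1 → ∃ S ∈ F, f - S ∈ V S := by
  classical
  have hc := WeakDual.isCompact_closedBall (𝕜 := ℝ) (E := X) 0 1
  let W : WeakDual ℝ X → Set (WeakDual ℝ X) := fun S =>
    {f | WeakDual.toStrongDual (f - S) ∈ V (WeakDual.toStrongDual S)}
  have hW : ∀ S ∈ WeakDual.toStrongDual ⁻¹' closedBall (0 : StrongDual ℝ X) 1, W S ∈ 𝓝 S := by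
    intro S _
    obtain ⟨I, δ, hδ, h⟩ := hV (WeakDual.toStrongDual S)
    have : ∀ x ∈ I, {f : WeakDual ℝ X | |f x - S x| < δ} ∈ 𝓝 S := by
      intro x _
      have hcont : Continuous fun f : WeakDual ℝ X => |f x - S x| :=
        ((WeakDual.eval_continuous x).sub continuous_const).abs
      refine hcont.continuousAt.preimage_mem_nhds (Iio_mem_nhds ?_)
      simpa using hδ
    refine Filter.mem_of_superset ((Filter.biInter_finset_mem I).2 this) fun f hf => ?_
    refine h _ fun x hx => ?_
    simpa using mem_iInter₂.1 hf x hx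
  obtain ⟨t, ht, hcov⟩ := hc.elim_nhds_subcover W hW
  refine ⟨t.image WeakDual.toStrongDual, ?_, fun f hf => ?_⟩
  · intro S hS
    obtain ⟨S', hS', rfl⟩ := Finset.mem_image.1 hS
    simpa using ht S' hS'
  · have : StrongDual.toWeakDual f ∈
        WeakDual.toStrongDual ⁻¹' closedBall (0 : StrongDual ℝ X) 1 := by
      simpa using hf
    have := hcov this
    simp only [mem_iUnion] at this
    obtain ⟨S, hS, hfS⟩ := this
    refine ⟨WeakDual.toStrongDual S, Finset.mem_image_of_mem _ hS, ?_⟩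
    exact hfS

end Weak

/-- Weak null perturbations satisfy an asymptotic upper `p`-estimate. -/
def WeakUpper (p : ℝ) (X : Type*) [NormedAddCommGroup X] [NormedSpace ℝ X] : Prop :=
  ∃ C > 0, ∀ y : X, ∀ R ε : ℝ, 0 < ε →
    ∀ᶠ z in weakZero X, ‖z‖ ≤ R → ‖y + z‖ ^ p ≤ ‖y‖ ^ p + C * ‖z‖ ^ p + ε

/-- Weak* null perturbations satisfy an asymptotic lower `q`-estimate. -/
def WeakStarLower (q : ℝ) (X : Type*) [NormedAddCommGroup X] [NormedSpace ℝ X] : Prop :=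
  ∃ c > 0, ∀ f : StrongDual ℝ X, ∀ R ε : ℝ, 0 < ε →
    ∀ᶠ g in weakStarZero X, ‖g‖ ≤ R → ‖f‖ ^ q + c * ‖g‖ ^ q ≤ ‖f + g‖ ^ q + ε

section

variable {X Y : Type*} [NormedAddCommGroup X] [NormedSpace ℝ X]
  [NormedAddCommGroup Y] [NormedSpace ℝ Y] {p q : ℝ}

lemma exists_almost_norming (f : StrongDual ℝ X) {η : ℝ} (hη : 0 < η) :
    ∃ y : X, ‖y‖ ≤ 1 ∧ ‖f‖ - η < f y := by
  obtain ⟨x, hx, h⟩ := f.exists_lt_apply_of_lt_opNorm (r := ‖f‖ - η) (by linarith)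
  rw [Real.norm_eq_abs, lt_abs] at h
  rcases h with h | h
  · exact ⟨x, hx.le, h⟩
  · exact ⟨-x, by simpa using hx.le, by simpa using h⟩

lemma rpow_sub_one_mul_self {x q : ℝ} (hx : 0 ≤ x) (hq : 1 < q) : x ^ (q - 1) * x = x ^ q := by
  rcases hx.eq_or_lt with rfl | h
  · rw [mul_zero, Real.zero_rpow (by linarith)]
  · rw [Real.rpow_sub_one h.ne']; field_simp

lemma rpow_conj (hpq : p.HolderConjugate q) {x : ℝ} (hx : 0 ≤ x) : (x ^ (q - 1)) ^ p = x ^ q := by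
  rw [← Real.rpow_mul hx]
  congr 1
  have := hpq.symm.sub_one_mul_conj
  linarith

set_option maxHeartbeats 1000000 in
lemma WeakUpper.weakStarLower (hpq : p.HolderConjugate q) (h : WeakUpper p X) :
    WeakStarLower q X := by
  obtain ⟨C, hC, h⟩ := h
  have hp := hpq.lt
  have hq := hpq.symm.lt
  have hp0 : 0 < p := by linarith
  have hq0 : 0 < q := by linarith
  set κ : ℝ := (1 / (C * 2 ^ p)) ^ (1 / (p - 1)) with hκ
  have hκ0 : 0 < κ := by positivity
  have hκp : C * 2 ^ p * κ ^ p = κ := by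
    have h1 : κ ^ (p - 1) = 1 / (C * 2 ^ p) := by
      rw [hκ, ← Real.rpow_mul (by positivity), one_div_mul_cancel (by linarith), Real.rpow_one]
    rw [← rpow_sub_one_mul_self hκ0.le hp, h1]
    field_simp
  refine ⟨κ, hκ0, fun f R ε hε => ?_⟩
  set ε' := ε / (2 * q) with hε'
  have hε'0 : 0 < ε' := by positivity
  set α := ‖f‖ ^ (q - 1) with hα
  set B := κ * |R| ^ (q - 1) with hB
  have hα0 : 0 ≤ α := by positivity
  have hB0 : 0 ≤ B := by positivity
  set η := ε' / (2 * α + 3 * B + 1) with hη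
  have hη0 : 0 < η := by positivity
  have hηε : (2 * α + 3 * B) * η ≤ ε' := by
    rw [hη, mul_div_assoc', div_le_iff₀ (by positivity)]; nlinarith
  obtain ⟨y, hy1, hyf⟩ := exists_almost_norming f hη0
  obtain ⟨I, δ, hδ, hI⟩ := h (α • y) (B * 2) ε' hε'0
  classical
  obtain ⟨F, hF1, hF⟩ := exists_finite_net (insert f I) (δ := min η (δ / (B + 1)))
    (lt_min hη0 (by positivity))
  filter_upwards [weakStarZero_abs_lt y hη0,
    (Finset.eventually_all F).2 fun s _ => weakStarZero_abs_lt s hη0] with g hgy hgF hgR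
  obtain ⟨x, hx1, hxg⟩ := exists_almost_norming g hη0
  obtain ⟨s, hsF, hs⟩ := hF x hx1
  set β := κ * ‖g‖ ^ (q - 1) with hβ
  have hβ0 : 0 ≤ β := by positivity
  have hβB : β ≤ B := by
    refine mul_le_mul_of_nonneg_left (Real.rpow_le_rpow (norm_nonneg _) ?_ (by linarith)) hκ0.le
    exact hgR.trans (le_abs_self _)
  set z := x - s with hz
  have hz2 : ‖z‖ ≤ 2 := by
    have := norm_sub_le x s
    linarith [hF1 s hsF]
  have hfz : |f z| < η := (hs f (Finset.mem_insert_self _ _)).trans_le (min_le_left _ _)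
  have hβz : ‖β • z‖ ≤ β * 2 := by
    rw [norm_smul, Real.norm_of_nonneg hβ0]
    exact mul_le_mul_of_nonneg_left hz2 hβ0
  have hW := hI (β • z) (fun φ hφ => by
    have h1 := (hs φ (Finset.mem_insert_of_mem hφ)).trans_le (min_le_right _ _)
    change |φ (β • z)| < δ
    rw [map_smul, smul_eq_mul, abs_mul, abs_of_nonneg hβ0]
    rw [lt_div_iff₀ (by positivity)] at h1
    nlinarith [abs_nonneg (φ z)]) (hβz.trans (by linarith))
  set w := α • y + β • z with hw
  have hαy : ‖α • y‖ ^ p ≤ ‖f‖ ^ q := by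
    rw [← rpow_conj hpq (norm_nonneg f), norm_smul, Real.norm_of_nonneg hα0]
    refine Real.rpow_le_rpow (by positivity) ?_ hp0.le
    nlinarith
  have hβzp : C * ‖β • z‖ ^ p ≤ κ * ‖g‖ ^ q := by
    calc C * ‖β • z‖ ^ p ≤ C * (β * 2) ^ p := by gcongr
      _ = (C * 2 ^ p * κ ^ p) * ‖g‖ ^ q := by
        rw [Real.mul_rpow hβ0 (by norm_num), hβ, Real.mul_rpow hκ0.le (by positivity),
          rpow_conj hpq (norm_nonneg g)]
        ring
      _ = _ := by rw [hκp]
  have hlow : ‖f‖ ^ q + κ * ‖g‖ ^ q - ε' ≤ (f + g) w := by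
    have e : (f + g) w = α * f y + β * f z + α * g y + β * (g x - g s) := by
      simp only [hw, hz, add_apply, map_add, map_smul, map_sub, smul_eq_mul]
      ring
    have e1 : α * ‖f‖ = ‖f‖ ^ q := rpow_sub_one_mul_self (norm_nonneg f) hq
    have e2 : β * ‖g‖ = κ * ‖g‖ ^ q := by
      rw [hβ, mul_assoc, rpow_sub_one_mul_self (norm_nonneg g) hq]
    have b1 : α * (‖f‖ - η) ≤ α * f y := mul_le_mul_of_nonneg_left hyf.le hα0
    have b2 : -(β * η) ≤ β * f z := by nlinarith [(abs_lt.1 hfz).1]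
    have b3 : -(α * η) ≤ α * g y := by nlinarith [(abs_lt.1 hgy).1]
    have b4 : β * (‖g‖ - 2 * η) ≤ β * (g x - g s) :=
      mul_le_mul_of_nonneg_left (by linarith [(abs_lt.1 (hgF s hsF)).2]) hβ0
    have b5 : β * η ≤ B * η := mul_le_mul_of_nonneg_right hβB hη0.le
    rw [e]
    linarith
  have hup : (f + g) w ≤ ‖f + g‖ ^ q / q + ‖w‖ ^ p / p :=
    (le_abs_self _).trans <| ((f + g).le_opNorm w).trans
      (Real.young_inequality_of_nonneg (norm_nonneg _) (norm_nonneg _) hpq.symm)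
  have hpq1 : 1 / p + 1 / q = 1 := by simpa using hpq.inv_add_inv_eq_one
  set A := ‖f‖ ^ q + κ * ‖g‖ ^ q with hA
  have h3 : A - ε' ≤ ‖f + g‖ ^ q / q + (A + ε') / p := by
    refine (hlow.trans hup).trans ?_
    gcongr
    linarith
  have h4 : A / q ≤ ‖f + g‖ ^ q / q + ε' * 2 := by
    have e1 : A = A / p + A / q := by
      calc A = A * (1 / p + 1 / q) := by rw [hpq1, mul_one]
        _ = _ := by ring
    have e2 : ε' / p ≤ ε' := div_le_self hε'0.le hp.le
    rw [add_div] at h3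
    linarith
  have h5 : ε' * 2 = ε / q := by rw [hε']; field_simp
  rw [h5, ← add_div] at h4
  exact (div_le_div_iff_of_pos_right hq0).1 h4

lemma pAUSable_of_weakStarLower (hpq : p.HolderConjugate q) (h : WeakStarLower q X)
    (T : Y →L[ℝ] X) {c : ℝ} (hc : 0 < c) (hT : ∀ y, c * ‖y‖ ≤ ‖T y‖) : PAUSable p Y := by
  obtain ⟨k, hk, h⟩ := h
  have hp := hpq.lt
  have hq := hpq.symm.lt
  have hp0 : 0 < p := by linarith
  have hq0 : 0 < q := by linarith
  have hnorm : IsNormFn Y fun y => ‖T y‖ := by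
    refine ⟨fun _ => norm_nonneg _, fun x => ⟨fun hx => ?_, fun hx => by simp [hx]⟩, fun a x => ?_,
      fun x y => ?_⟩
    · have := hT x
      rw [← norm_le_zero_iff]
      simp only at hx
      nlinarith [norm_nonneg x]
    · simp [norm_smul]
    · simpa using norm_add_le (T x) (T y)
  refine ⟨fun y => ‖T y‖, ⟨hnorm, c, hc, ‖T‖ + 1, by positivity, fun x => ⟨hT x, ?_⟩⟩, ?_⟩
  · exact (T.le_opNorm x).trans (by nlinarith [norm_nonneg x])
  set C := (k ^ (-1 / q)) ^ p / p with hC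
  refine ⟨C, by positivity, fun τ hτ => ?_⟩
  have hCτ : 0 ≤ C * τ ^ p := by positivity
  unfold rhoN
  split_ifs
  · exact hCτ
  refine Real.sSup_le ?_ hCτ
  rintro r ⟨y, hy, rfl⟩
  refine le_of_forall_pos_le_add fun ε hε => ?_
  obtain ⟨F, -, hF⟩ := exists_finite_cover (X := X) (fun S => {g | (‖g‖ ≤ ‖S‖ + 1 →
    ‖S‖ ^ q + k * ‖g‖ ^ q ≤ ‖S + g‖ ^ q + ε / 2) ∧ |g (T y)| < ε / 2}) (fun S =>
    (h S (‖S‖ + 1) (ε / 2) (by positivity)).and (weakStarZero_abs_lt _ (by positivity)))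
  let Φ : Y →L[ℝ] (F → ℝ) := ContinuousLinearMap.pi fun S => S.1.comp T
  refine (csInf_le (a := sSup { t : ℝ | ∃ x ∈ LinearMap.ker Φ.toLinearMap,
    ‖T x‖ ≤ 1 ∧ t = ‖T (y + τ • x)‖ - 1 }) ?_ ?_).trans ?_
  · refine ⟨min (‖T y‖ - 1) 0, ?_⟩
    rintro s ⟨E, -, -, rfl⟩
    by_cases hb : BddAbove {t : ℝ | ∃ x ∈ E, ‖T x‖ ≤ 1 ∧ t = ‖T (y + τ • x)‖ - 1}
    · exact (min_le_left _ _).trans (le_csSup hb ⟨0, E.zero_mem, by simp, by simp⟩)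
    · rw [Real.sSup_of_not_bddAbove hb]
      exact min_le_right _ _
  · refine ⟨_, Φ.isClosed_ker, ?_, rfl⟩
    exact (LinearMap.quotKerEquivRange Φ.toLinearMap).symm.finiteDimensional
  · refine Real.sSup_le ?_ (by positivity)
    rintro t ⟨x, hx, hx1, rfl⟩
    obtain ⟨f, hf1, hf⟩ := exists_dual_vector'' ℝ (T (y + τ • x))
    obtain ⟨S, hS, hg, hgy⟩ := hF f hf1
    set g := f - S with hgdef
    have hSx : S (T x) = 0 := congrFun (LinearMap.mem_ker.1 hx) ⟨S, hS⟩
    have hgn : ‖g‖ ≤ ‖S‖ + 1 := (norm_sub_le f S).trans (by linarith)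
    have hfS : S + g = f := by rw [hgdef]; abel
    have h1 := hg hgn
    rw [hfS] at h1
    have h2 : ‖f‖ ^ q ≤ 1 := Real.rpow_le_one (norm_nonneg _) hf1 hq0.le
    have h3 : ‖T (y + τ • x)‖ ≤ ‖S‖ + ε / 2 + τ * ‖g‖ := by
      have e : ‖T (y + τ • x)‖ = S (T y) + g (T y) + τ * g (T x) := by
        have : ‖T (y + τ • x)‖ = f (T (y + τ • x)) := by simpa using hf.symm
        rw [this, ← hfS]
        simp only [add_apply, map_add, map_smul, smul_eq_mul, hSx]
        ring
      have b1 : S (T y) ≤ ‖S‖ :=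
        (le_abs_self _).trans ((S.le_opNorm _).trans (by nlinarith [norm_nonneg S]))
      have b2 : g (T x) ≤ ‖g‖ :=
        (le_abs_self _).trans ((g.le_opNorm _).trans (by nlinarith [norm_nonneg g]))
      rw [e]
      nlinarith [(abs_lt.1 hgy).2]
    have h4 : ‖S‖ * 1 ≤ ‖S‖ ^ q / q + 1 ^ p / p :=
      Real.young_inequality_of_nonneg (norm_nonneg _) zero_le_one hpq.symm
    have h5 : (k ^ (1 / q) * ‖g‖) * (k ^ (-1 / q) * τ) ≤
        (k ^ (1 / q) * ‖g‖) ^ q / q + (k ^ (-1 / q) * τ) ^ p / p :=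
      Real.young_inequality_of_nonneg (by positivity) (by positivity) hpq.symm
    have e1 : (k ^ (1 / q) * ‖g‖) * (k ^ (-1 / q) * τ) = τ * ‖g‖ := by
      have : k ^ (1 / q) * k ^ (-1 / q) = 1 := by
        rw [← Real.rpow_add hk, ← add_div]; simp
      linear_combination (τ * ‖g‖) * this
    have e2 : (k ^ (1 / q) * ‖g‖) ^ q = k * ‖g‖ ^ q := by
      rw [Real.mul_rpow (by positivity) (by positivity), ← Real.rpow_mul hk.le,
        one_div_mul_cancel hq0.ne', Real.rpow_one]
    have e3 : (k ^ (-1 / q) * τ) ^ p / p = C * τ ^ p := by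
      rw [Real.mul_rpow (by positivity) hτ, hC]; ring
    rw [e1, e2, e3] at h5
    rw [Real.one_rpow] at h4
    have hpq1 : 1 / p + 1 / q = 1 := by simpa using hpq.inv_add_inv_eq_one
    have h6 : ‖S‖ ^ q / q + k * ‖g‖ ^ q / q ≤ 1 / q + ε / 2 := by
      rw [← add_div]
      calc (‖S‖ ^ q + k * ‖g‖ ^ q) / q ≤ (1 + ε / 2) / q :=
            div_le_div_of_nonneg_right (by linarith) hq0.le
        _ = 1 / q + ε / 2 / q := add_div _ _ _
        _ ≤ _ := by linarith [div_le_self (half_pos hε).le hq.le]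
    linarith

lemma WeakStarLower.of_isometry (T : X →L[ℝ] Y) (hT : ∀ f : StrongDual ℝ Y, ‖f.comp T‖ = ‖f‖)
    (h : WeakStarLower q X) : WeakStarLower q Y := by
  obtain ⟨c, hc, h⟩ := h
  refine ⟨c, hc, fun f R ε hε => ?_⟩
  filter_upwards [(tendsto_weakStarZero T).eventually (h (f.comp T) R ε hε)] with g hg hgR
  rw [hT, hT, ← ContinuousLinearMap.add_comp, hT] at hg
  exact hg hgR

lemma norm_comp_mkQL (S : Submodule ℝ X) [IsClosed (S : Set X)] (f : StrongDual ℝ (X ⧸ S)) :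
    ‖f.comp S.mkQL‖ = ‖f‖ := by
  refine le_antisymm ?_ ?_
  · refine ContinuousLinearMap.opNorm_le_bound _ (ContinuousLinearMap.opNorm_nonneg _) fun x => ?_
    refine (f.le_opNorm _).trans
      (mul_le_mul_of_nonneg_left ?_ (ContinuousLinearMap.opNorm_nonneg _))
    exact Submodule.Quotient.norm_mk_le S x
  · refine ContinuousLinearMap.opNorm_le_bound _ (ContinuousLinearMap.opNorm_nonneg _) fun x => ?_
    refine le_of_forall_pos_le_add fun ε hε => ?_
    set M := ‖f.comp S.mkQL‖
    obtain ⟨m, rfl, hlt⟩ := Submodule.Quotient.norm_mk_lt (S := S) x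
      (ε := ε / (M + 1)) (by positivity)
    have h1 : ‖f.comp S.mkQL m‖ ≤ M * ‖m‖ := (f.comp S.mkQL).le_opNorm m
    have hM : M * (ε / (M + 1)) ≤ ε := by
      rw [mul_div_assoc', div_le_iff₀ (by positivity)]
      nlinarith [norm_nonneg (f.comp S.mkQL)]
    refine h1.trans ?_
    have := mul_le_mul_of_nonneg_left hlt.le (norm_nonneg (f.comp S.mkQL))
    rw [mul_add] at this
    exact this.trans (by gcongr)

lemma pAUSable_of_quotient [CompleteSpace X] [CompleteSpace Y] (hpq : p.HolderConjugate q)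
    (h : WeakStarLower q X) (Q : X →L[ℝ] Y) (hQ : Function.Surjective Q) : PAUSable p Y := by
  have hcl : IsClosed (LinearMap.ker Q.toLinearMap : Set X) := Q.isClosed_ker
  have h' : WeakStarLower q (X ⧸ LinearMap.ker Q.toLinearMap) :=
    h.of_isometry (Submodule.mkQL _) (norm_comp_mkQL _)
  let L := (LinearMap.ker Q.toLinearMap).liftQ Q.toLinearMap le_rfl
  have hL : ∀ x, ‖L x‖ ≤ ‖Q‖ * ‖x‖ := by
    intro x
    refine le_of_forall_pos_le_add fun ε hε => ?_
    obtain ⟨m, rfl, hlt⟩ := Submodule.Quotient.norm_mk_lt (S := LinearMap.ker Q.toLinearMap) x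
      (ε := ε / (‖Q‖ + 1)) (by positivity)
    have h1 : ‖Q m‖ ≤ ‖Q‖ * ‖m‖ := Q.le_opNorm m
    have hM : ‖Q‖ * (ε / (‖Q‖ + 1)) ≤ ε := by
      rw [mul_div_assoc', div_le_iff₀ (by positivity)]
      nlinarith [norm_nonneg Q]
    have := mul_le_mul_of_nonneg_left hlt.le (norm_nonneg Q)
    rw [mul_add] at this
    exact h1.trans (this.trans (by gcongr))
  let L' := L.mkContinuous ‖Q‖ hL
  have hbij : Function.Bijective L' := by
    constructor
    · exact LinearMap.ker_eq_bot.1 (Submodule.ker_liftQ_eq_bot _ _ _ le_rfl)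
    · intro y
      obtain ⟨x, rfl⟩ := hQ y
      exact ⟨Submodule.Quotient.mk x, rfl⟩
  let e := ContinuousLinearEquiv.ofBijective L' (LinearMap.ker_eq_bot.2 hbij.1)
    (LinearMap.range_eq_top.2 hbij.2)
  refine pAUSable_of_weakStarLower hpq h' e.symm.toContinuousLinearMap
    (c := (‖L'‖ + 1)⁻¹) (inv_pos.2 (by linarith [L'.opNorm_nonneg])) fun y => ?_
  rw [inv_mul_le_iff₀ (by linarith [L'.opNorm_nonneg])]
  have := L'.le_opNorm (e.symm y)
  have h2 : L' (e.symm y) = y := e.apply_symm_apply y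
  rw [h2] at this
  have h3 := norm_nonneg (e.symm y)
  change ‖y‖ ≤ (‖L'‖ + 1) * ‖e.symm y‖
  linarith

end

lemma add_rpow_le_two {a b p : ℝ} (ha : 0 ≤ a) (hb : 0 ≤ b) (hp : 0 ≤ p) :
    (a + b) ^ p ≤ 2 ^ p * (a ^ p + b ^ p) := by
  have h1 : 0 ≤ a ^ p := by positivity
  have h2 : 0 ≤ b ^ p := by positivity
  rcases le_total a b with h | h
  · calc (a + b) ^ p ≤ (2 * b) ^ p := Real.rpow_le_rpow (by positivity) (by linarith) hp
      _ = 2 ^ p * b ^ p := Real.mul_rpow (by norm_num) hb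
      _ ≤ _ := by gcongr; linarith
  · calc (a + b) ^ p ≤ (2 * a) ^ p := Real.rpow_le_rpow (by positivity) (by linarith) hp
      _ = 2 ^ p * a ^ p := Real.mul_rpow (by norm_num) ha
      _ ≤ _ := by gcongr; linarith

lemma one_add_rpow_le {u p : ℝ} (hu : 0 ≤ u) (hp : 1 ≤ p) :
    (1 + u) ^ p ≤ 1 + p * (1 + u) ^ (p - 1) * u := by
  have h0 : (0 : ℝ) < 1 + u := by linarith
  have h := one_add_mul_self_le_rpow_one_add (s := -(u / (1 + u)))
    (by rw [neg_le_neg_iff, div_le_one h0]; linarith) hp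
  have e : 1 + -(u / (1 + u)) = (1 + u)⁻¹ := by field_simp; ring
  rw [e, Real.inv_rpow h0.le] at h
  have hpos : 0 < (1 + u) ^ p := by positivity
  have h2 := mul_le_mul_of_nonneg_left h hpos.le
  rw [mul_inv_cancel₀ hpos.ne'] at h2
  rw [Real.rpow_sub_one h0.ne']
  have e2 : (1 + u) ^ p * (1 + p * -(u / (1 + u))) =
    (1 + u) ^ p - p * ((1 + u) ^ p / (1 + u)) * u := by field_simp; ring
  linarith

section

variable {X : Type*} [NormedAddCommGroup X] [NormedSpace ℝ X] {p : ℝ}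

lemma exists_subspace_of_isPAUSNorm {N : X → ℝ} (hN : IsNormFn X N) (h : IsPAUSNorm X N p) :
    ∃ C > 0, ∀ y : X, N y ≤ 1 → ∀ τ : ℝ, 0 ≤ τ → ∀ η > 0, ∃ E : Submodule ℝ X,
      IsClosed (E : Set X) ∧ FiniteDimensional ℝ (X ⧸ E) ∧
        ∀ x ∈ E, N x ≤ 1 → N (y + τ • x) ≤ 1 + C * τ ^ p + η := by
  obtain ⟨C, hC, h⟩ := h
  obtain ⟨hN0, hNz, hNs, hNa⟩ := hN
  refine ⟨C, hC, fun y hy τ hτ η hη => ?_⟩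
  have hbd : ∀ y : X, N y ≤ 1 → ∀ x : X, N x ≤ 1 → N (y + τ • x) - 1 ≤ τ := by
    intro y hy x hx
    have := hNa y (τ • x)
    rw [hNs, abs_of_nonneg hτ] at this
    nlinarith
  have h := h τ hτ
  unfold rhoN at h
  split_ifs at h with hfd
  · refine ⟨⊥, isClosed_singleton, inferInstance, fun x hx _ => ?_⟩
    rw [(Submodule.mem_bot ℝ).1 hx, smul_zero, add_zero]
    linarith [show 0 ≤ C * τ ^ p by positivity]
  let S : X → Set ℝ := fun y => { s : ℝ | ∃ E : Submodule ℝ X, IsClosed (E : Set X) ∧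
    FiniteDimensional ℝ (X ⧸ E) ∧ s = sSup { t : ℝ | ∃ x ∈ E, N x ≤ 1 ∧ t = N (y + τ • x) - 1 } }
  have hbdd : ∀ y, N y ≤ 1 → ∀ E : Submodule ℝ X,
      BddAbove { t : ℝ | ∃ x ∈ E, N x ≤ 1 ∧ t = N (y + τ • x) - 1 } := by
    rintro y hy E
    refine ⟨τ, ?_⟩
    rintro t ⟨x, -, hx, rfl⟩
    exact hbd y hy x hx
  have hmem : ∀ y, sSup { t : ℝ | ∃ x ∈ (⊤ : Submodule ℝ X), N x ≤ 1 ∧ t = N (y + τ • x) - 1 } ∈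
      S y := fun y => ⟨⊤, isClosed_univ, inferInstance, rfl⟩
  have hSle : ∀ y, N y ≤ 1 → sInf (S y) ≤ τ := by
    intro y hy
    refine (csInf_le ?_ (hmem y)).trans (Real.sSup_le ?_ hτ)
    · refine ⟨-1, ?_⟩
      rintro s ⟨E, -, -, rfl⟩
      refine le_csSup_of_le (hbdd y hy E) ⟨0, E.zero_mem, ?_, rfl⟩ ?_
      · rw [(hNz 0).2 rfl]; exact zero_le_one
      · linarith [hN0 (y + τ • (0 : X))]
    · rintro t ⟨x, -, hx, rfl⟩
      exact hbd y hy x hx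
  have hlt : sInf (S y) < C * τ ^ p + η := by
    have hle : sInf (S y) ≤ sSup {r : ℝ | ∃ y : X, N y ≤ 1 ∧ r = sInf (S y)} := by
      refine le_csSup ⟨τ, ?_⟩ ⟨y, hy, rfl⟩
      rintro r ⟨y, hy, rfl⟩
      exact hSle y hy
    exact (hle.trans h).trans_lt (lt_add_of_pos_right _ hη)
  obtain ⟨s, ⟨E, hE, hEfd, rfl⟩, hs⟩ := exists_lt_of_csInf_lt
    ⟨_, hmem y⟩ hlt
  refine ⟨E, hE, hEfd, fun x hx hx1 => ?_⟩
  have := le_csSup (hbdd y hy E) ⟨x, hx, hx1, rfl⟩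
  linarith

/-- The upper estimate of a `p`-AUS norm, with almost membership in finite-codimensional subspaces
expressed through the weak topology. -/
def SubspaceUpper (p : ℝ) (X : Type*) [NormedAddCommGroup X] [NormedSpace ℝ X] : Prop :=
  ∃ C > 0, ∀ y : X, ‖y‖ ≤ 1 → ∀ τ : ℝ, 0 ≤ τ → ∀ η > 0, ∃ E : Submodule ℝ X,
    (∀ δ > 0, ∀ᶠ z in weakZero X, ∃ e ∈ E, ‖z - e‖ < δ) ∧
      ∀ x ∈ E, ‖x‖ ≤ 1 → ‖y + τ • x‖ ≤ 1 + C * τ ^ p + η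

/-- A copy of a vector space without its norm. -/
def Unnormed (X : Type u) : Type u := X

instance (X : Type u) [AddCommGroup X] : AddCommGroup (Unnormed X) :=
  inferInstanceAs (AddCommGroup X)

instance (X : Type u) [AddCommGroup X] [Module ℝ X] : Module ℝ (Unnormed X) :=
  inferInstanceAs (Module ℝ X)

lemma exists_renorming {X : Type u} [NormedAddCommGroup X] [NormedSpace ℝ X] {N : X → ℝ}
    (hN : IsEquivNorm X N) :
    ∃ (X' : Type u) (_ : NormedAddCommGroup X') (_ : NormedSpace ℝ X') (e : X ≃L[ℝ] X'),
      ∀ x, ‖e x‖ = N x := by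
  obtain ⟨⟨hN0, hNz, hNs, hNa⟩, a, ha, b, hb, hab⟩ := hN
  let X' := Unnormed X
  let i0 : Norm X' := ⟨fun x => N x⟩
  have core : NormedSpace.Core ℝ X' :=
    { norm_nonneg := fun x => hN0 _
      norm_smul := fun c x => hNs c x
      norm_triangle := fun x y => hNa x y
      norm_eq_zero_iff := fun x => (hNz x).trans Iff.rfl }
  let i1 : NormedAddCommGroup X' := NormedAddCommGroup.ofCore core
  let i2 : NormedSpace ℝ X' := NormedSpace.ofCore core
  let e : X ≃ₗ[ℝ] X' := LinearEquiv.refl ℝ X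
  refine ⟨X', i1, i2, ⟨e, ?_, ?_⟩, fun x => rfl⟩
  · exact (LinearMap.mkContinuous e.toLinearMap b fun x => (hab x).2).continuous
  · refine (LinearMap.mkContinuous e.symm.toLinearMap a⁻¹ fun x => ?_).continuous
    have := (hab x).1
    rw [← le_inv_mul_iff₀ ha] at this
    exact this

lemma subspaceUpper_of_renorming {X' : Type*} [NormedAddCommGroup X'] [NormedSpace ℝ X']
    {N : X → ℝ} (hN : IsNormFn X N) (h : IsPAUSNorm X N p) (e : X ≃L[ℝ] X')
    (he : ∀ x, ‖e x‖ = N x) : SubspaceUpper p X' := by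
  obtain ⟨C, hC, h⟩ := exists_subspace_of_isPAUSNorm hN h
  refine ⟨C, hC, fun y hy τ hτ η hη => ?_⟩
  have hes : ∀ y, N (e.symm y) = ‖y‖ := fun y => by rw [← he, e.apply_symm_apply]
  obtain ⟨E, hE, hEfd, hEx⟩ := h (e.symm y) (by rwa [hes]) τ hτ η hη
  refine ⟨E.comap e.symm.toLinearEquiv.toLinearMap, fun δ hδ => ?_, fun x hx hx1 => ?_⟩
  · filter_upwards [(tendsto_weakZero e.symm.toContinuousLinearMap).eventually
      (weakZero_near hE (δ := δ / (‖e.toContinuousLinearMap‖ + 1)) (by positivity))] with z hz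
    obtain ⟨w, hw, hwz⟩ := hz
    refine ⟨e w, by simpa using hw, ?_⟩
    rw [lt_div_iff₀ (by positivity)] at hwz
    have h1 := e.toContinuousLinearMap.le_opNorm (e.symm z - w)
    have h2 : e.toContinuousLinearMap (e.symm z - w) = z - e w := by simp
    rw [h2] at h1
    have h3 : ‖e.symm.toContinuousLinearMap z - w‖ = ‖e.symm z - w‖ := rfl
    rw [h3] at hwz
    nlinarith [norm_nonneg (e.symm z - w)]
  · have := hEx (e.symm x) hx (by rwa [hes])
    rwa [← map_smul, ← map_add, hes] at this

lemma exists_rpow_le_add (p : ℝ) (hp : 0 < p) {a ε : ℝ} (hε : 0 < ε) :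
    ∃ θ > 0, ∀ t, 0 ≤ t → t ≤ a + θ → t ^ p ≤ a ^ p + ε := by
  have hc : ContinuousAt (fun t : ℝ => t ^ p) a :=
    (Real.continuousAt_rpow_const _ _ (Or.inr hp.le))
  obtain ⟨θ, hθ, h⟩ := Metric.continuousAt_iff.1 hc ε hε
  refine ⟨θ / 2, by positivity, fun t ht hta => ?_⟩
  have h1 := @h (a + θ / 2) (by
    rw [Real.dist_eq, add_sub_cancel_left, abs_of_pos (half_pos hθ)]; linarith)
  rw [Real.dist_eq] at h1
  have h2 : t ^ p ≤ (a + θ / 2) ^ p := Real.rpow_le_rpow ht hta hp.le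
  linarith [(abs_lt.1 h1).2]

lemma SubspaceUpper.bounded (hp : 1 < p) (h : SubspaceUpper p X) :
    ∃ C > 0, ∀ y : X, ∀ τ > 0, ∀ ε > 0,
      ∀ᶠ z in weakZero X, ‖z‖ ≤ τ → ‖y + z‖ ^ p ≤ ‖y‖ ^ p + C * τ ^ p + ε := by
  obtain ⟨C, hC, h⟩ := h
  have hp0 : 0 < p := by linarith
  set M := p * (1 + C * 2 ^ p) ^ (p - 1) with hM
  have hM0 : 0 < M := by positivity
  refine ⟨2 ^ p + M * (C * 2 ^ p), by positivity, fun y τ hτ ε hε => ?_⟩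
  rcases le_or_gt ‖y‖ τ with hyτ | hyτ
  · refine Eventually.of_forall fun z hz => ?_
    have h1 : ‖y + z‖ ^ p ≤ (2 * τ) ^ p :=
      Real.rpow_le_rpow (norm_nonneg _) ((norm_add_le y z).trans (by linarith)) hp0.le
    rw [Real.mul_rpow (by norm_num) hτ.le] at h1
    have h2 : 0 ≤ ‖y‖ ^ p := by positivity
    have h3 : 0 ≤ M * (C * 2 ^ p) * τ ^ p := by positivity
    linarith
  set l := ‖y‖ with hl
  have hl0 : 0 < l := hτ.trans hyτ
  set τ' := 2 * τ / l with hτ'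
  have hτ'0 : 0 < τ' := by positivity
  have hτ'2 : τ' ≤ 2 := by rw [hτ', div_le_iff₀ hl0]; linarith
  set u := C * τ' ^ p with hu
  have hu0 : 0 < u := by positivity
  obtain ⟨θ, hθ, hθp⟩ := exists_rpow_le_add p hp0 (a := l * (1 + u)) hε
  obtain ⟨E, hE, hEx⟩ := h (l⁻¹ • y)
    (by rw [norm_smul, norm_inv, norm_norm, inv_mul_cancel₀ hl0.ne']) τ' hτ'0.le
    (θ / (2 * l)) (by positivity)
  filter_upwards [hE (min τ (θ / 2)) (by positivity)] with z hz hzτ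
  obtain ⟨e, he, hze⟩ := hz
  have hze1 := hze.trans_le (min_le_left _ _)
  have hze2 := hze.trans_le (min_le_right _ _)
  have he2 : ‖e‖ ≤ 2 * τ := by
    have := norm_sub_le z (z - e)
    rw [sub_sub_cancel] at this
    linarith
  have h1 := hEx ((2 * τ)⁻¹ • e) (E.smul_mem _ he) (by
    rw [norm_smul, norm_inv, Real.norm_of_nonneg (by positivity), inv_mul_le_iff₀ (by positivity)]
    simpa using he2)
  have e1 : y + e = l • (l⁻¹ • y + τ' • (2 * τ)⁻¹ • e) := by
    rw [smul_add, smul_smul, smul_smul, smul_smul, mul_inv_cancel₀ hl0.ne', one_smul]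
    congr 1
    have : l * τ' * (2 * τ)⁻¹ = 1 := by rw [hτ']; field_simp
    rw [this, one_smul]
  have h2 : ‖y + e‖ ≤ l * (1 + u + θ / (2 * l)) := by
    rw [e1, norm_smul, Real.norm_of_nonneg hl0.le]
    exact mul_le_mul_of_nonneg_left h1 hl0.le
  have h3 : ‖y + z‖ ≤ l * (1 + u) + θ := by
    have e2 : y + z = (y + e) + (z - e) := by abel
    have e3 : l * (1 + u + θ / (2 * l)) = l * (1 + u) + θ / 2 := by field_simp
    have := norm_add_le (y + e) (z - e)
    rw [← e2] at this
    linarith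
  have h4 := hθp _ (norm_nonneg _) h3
  have huK : u ≤ C * 2 ^ p := by rw [hu]; gcongr
  have h5 : (1 + u) ^ p ≤ 1 + M * u := by
    refine (one_add_rpow_le hu0.le hp.le).trans ?_
    have : (1 + u) ^ (p - 1) ≤ (1 + C * 2 ^ p) ^ (p - 1) :=
      Real.rpow_le_rpow (by positivity) (by linarith) (by linarith)
    have := mul_le_mul_of_nonneg_right (mul_le_mul_of_nonneg_left this hp0.le) hu0.le
    linarith
  have h6 : (l * (1 + u)) ^ p ≤ l ^ p + M * (C * 2 ^ p) * τ ^ p := by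
    rw [Real.mul_rpow hl0.le (by positivity)]
    calc l ^ p * (1 + u) ^ p ≤ l ^ p * (1 + M * u) := by gcongr
      _ = l ^ p + M * (C * 2 ^ p) * τ ^ p := by
        rw [hu, hτ', Real.div_rpow (by positivity) hl0.le, Real.mul_rpow (by norm_num) hτ.le]
        have : 0 < l ^ p := by positivity
        field_simp
  have h7 : 0 ≤ 2 ^ p * τ ^ p := by positivity
  linarith

lemma SubspaceUpper.weakUpper (hp : 1 < p) (h : SubspaceUpper p X) : WeakUpper p X := by
  obtain ⟨C, hC, h⟩ := h.bounded hp
  have hp0 : 0 < p := by linarith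
  refine ⟨C * 2 ^ p, by positivity, fun y R ε hε => ?_⟩
  set δ := (ε / (2 * (C * 2 ^ p))) ^ (1 / p) with hδ
  have hδ0 : 0 < δ := by positivity
  have hδp : C * 2 ^ p * δ ^ p = ε / 2 := by
    rw [hδ, ← Real.rpow_mul (by positivity), one_div_mul_cancel hp0.ne', Real.rpow_one]
    field_simp
  have hev := (Finset.eventually_all (Finset.range (⌊R / δ⌋₊ + 1))).2
    fun i _ => h y ((i + 1 : ℕ) * δ) (by positivity) (ε / 2) (by positivity)
  filter_upwards [hev] with z hz hzR
  set i := ⌊‖z‖ / δ⌋₊ with hi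
  have h1 : ‖z‖ ≤ (i + 1 : ℕ) * δ := by
    rw [← div_le_iff₀ hδ0]
    exact_mod_cast (Nat.lt_floor_add_one _).le
  have h2 : (i + 1 : ℕ) * δ ≤ ‖z‖ + δ := by
    have : (i : ℝ) ≤ ‖z‖ / δ := Nat.floor_le (by positivity)
    rw [le_div_iff₀ hδ0] at this
    push_cast
    linarith
  have h3 := hz i (Finset.mem_range.2 (Nat.lt_succ_of_le (Nat.floor_le_floor (by gcongr)))) h1
  have h4 : (((i + 1 : ℕ) : ℝ) * δ) ^ p ≤ 2 ^ p * (‖z‖ ^ p + δ ^ p) :=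
    (Real.rpow_le_rpow (by positivity) h2 hp0.le).trans
      (add_rpow_le_two (norm_nonneg _) hδ0.le hp0.le)
  have h5 := mul_le_mul_of_nonneg_left h4 hC.le
  linarith

end

section

variable {V : Type*} [NormedAddCommGroup V] [NormedSpace ℝ V] {p : ℝ}

lemma exists_rpow_uniform (hp : 0 < p) (B : ℝ) {ε : ℝ} (hε : 0 < ε) :
    ∃ δ > 0, ∀ s t, 0 ≤ s → s ≤ B → 0 ≤ t → t ≤ B → s ≤ t + δ → s ^ p ≤ t ^ p + ε := by
  have hc : ContinuousOn (fun t : ℝ => t ^ p) (Icc 0 B) :=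
    (Real.continuous_rpow_const hp.le).continuousOn
  obtain ⟨δ, hδ, h⟩ := Metric.uniformContinuousOn_iff.1
    (isCompact_Icc.uniformContinuousOn_of_continuous hc) ε hε
  refine ⟨δ / 2, by positivity, fun s t hs hsB ht htB hst => ?_⟩
  rcases le_or_gt s t with h1 | h1
  · linarith [Real.rpow_le_rpow hs h1 hp.le]
  · have := h s ⟨hs, hsB⟩ t ⟨ht, htB⟩
      (by rw [Real.dist_eq, abs_of_pos (by linarith)]; linarith)
    rw [Real.dist_eq] at this
    linarith [(abs_lt.1 this).2]

variable (R : ℕ → Submodule ℝ V)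

lemma exists_near_of_mem_closure (hmono : Monotone R) {y : V}
    (hy : y ∈ (⨆ k, R k).topologicalClosure) {δ : ℝ} (hδ : 0 < δ) :
    ∃ k, ∃ y' ∈ R k, ‖y - y'‖ < δ := by
  obtain ⟨y', hy', h⟩ := Metric.mem_closure_iff.1 hy δ hδ
  obtain ⟨k, hk⟩ := (Submodule.mem_iSup_of_directed R hmono.directed_le).1 hy'
  exact ⟨k, y', hk, by rwa [← dist_eq_norm]⟩

lemma separableSpace_closure (hmono : Monotone R) [∀ k, FiniteDimensional ℝ (R k)] :
    TopologicalSpace.SeparableSpace (⨆ k, R k).topologicalClosure := by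
  have h : TopologicalSpace.IsSeparable (⋃ k, (R k : Set V)) := by
    refine TopologicalSpace.IsSeparable.iUnion fun k => ?_
    have := (TopologicalSpace.isSeparable_univ_iff.2
      (inferInstance : TopologicalSpace.SeparableSpace (R k))).image (continuous_subtype_val)
    simpa using this
  have e : ((⨆ k, R k : Submodule ℝ V) : Set V) = ⋃ k, (R k : Set V) :=
    Submodule.coe_iSup_of_directed R hmono.directed_le
  rw [← e] at h
  exact h.closure.separableSpace

/-- A monotone approximation by contractive projections with an upper `p`-estimate gives the
asymptotic upper estimate on the closed span. -/
lemma weakUpper_closure (hp : 1 < p) (hmono : Monotone R) [∀ k, FiniteDimensional ℝ (R k)]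
    (P : ℕ → V →L[ℝ] V) (hP : ∀ k v, ‖P k v‖ ≤ ‖v‖)
    (hPR : ∀ k j, ∀ u ∈ R j, P k u ∈ R k)
    (hest : ∀ k j, ∀ u ∈ R k, ∀ v ∈ R j,
      ‖u + (v - P k v)‖ ^ p ≤ ‖u‖ ^ p + ‖v - P k v‖ ^ p) :
    WeakUpper p (⨆ k, R k).topologicalClosure := by
  have hp0 : 0 < p := by linarith
  refine ⟨1, one_pos, fun y r ε hε => ?_⟩
  obtain ⟨δ', hδ', hδu⟩ := exists_rpow_uniform (p := p) hp0 (‖y‖ + |r| + 8) (ε := ε / 3)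
    (by positivity)
  set δ := min 1 (δ' / 4) with hδ
  have hδ0 : 0 < δ := by positivity
  have hδ1 : δ ≤ 1 := min_le_left _ _
  have hδ4 : 4 * δ ≤ δ' := by linarith [min_le_right 1 (δ' / 4)]
  obtain ⟨n, y', hy', hyy'⟩ := exists_near_of_mem_closure R hmono y.2 hδ0
  have hmem : ∀ z : (⨆ k, R k).topologicalClosure, P n z ∈ R n := by
    intro z
    have hcl : IsClosed (R n : Set V) := (R n).closed_of_finiteDimensional
    by_contra hz
    have : (P n ⁻¹' (R n : Set V))ᶜ ∈ 𝓝 (z : V) :=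
      (hcl.preimage (P n).continuous).isOpen_compl.mem_nhds hz
    obtain ⟨η, hη, hball⟩ := Metric.mem_nhds_iff.1 this
    obtain ⟨k, z', hz', hzz'⟩ := exists_near_of_mem_closure R hmono z.2 hη
    have hzb : z' ∈ ball (z : V) η := by rwa [mem_ball, dist_comm, dist_eq_norm]
    exact hball hzb (hPR n k z' hz')
  let T : (⨆ k, R k).topologicalClosure →L[ℝ] R n :=
    ((P n).comp (Submodule.subtypeL _)).codRestrict (R n) hmem
  filter_upwards [weakZero_norm_lt T hδ0] with z hz hzr
  have hz' : ‖P n z‖ < δ := hz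
  obtain ⟨j, w, hw, hzw⟩ := exists_near_of_mem_closure R hmono z.2 hδ0
  have h1 : ‖P n w‖ ≤ 2 * δ := by
    have e : P n w = P n z - P n (z - w) := by rw [map_sub]; abel
    rw [e]
    refine (norm_sub_le _ _).trans ?_
    linarith [hP n (z - w)]
  have hest' := hest n j y' hy' w hw
  have hny : ‖y'‖ ≤ ‖y‖ + δ := by
    have e : y' = y - (y - y') := by abel
    have := norm_sub_le (y : V) (y - y')
    rw [← e] at this
    have : ‖(y : V)‖ = ‖y‖ := rfl
    linarith
  have hnw : ‖w - P n w‖ ≤ ‖z‖ + 3 * δ := by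
    have e : w - P n w = z - (z - w) - P n w := by abel
    have h2 := norm_sub_le (z - (z - w)) (P n w)
    have h3 := norm_sub_le (z : V) (z - w)
    rw [← e] at h2
    have : ‖(z : V)‖ = ‖z‖ := rfl
    linarith
  have hsum : ‖y + z‖ ≤ ‖y' + (w - P n w)‖ + 4 * δ := by
    have e : (y : V) + z = (y' + (w - P n w)) + (y - y') + (z - w) + P n w := by abel
    have h2 := norm_add_le ((y' + (w - P n w)) + (y - y') + (z - w)) (P n w)
    have h3 := norm_add_le ((y' + (w - P n w)) + (y - y')) (z - w)
    have h4 := norm_add_le (y' + (w - P n w)) (y - y')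
    rw [← e] at h2
    have : ‖(y : V) + z‖ = ‖y + z‖ := rfl
    linarith
  have hr : ‖z‖ ≤ |r| := hzr.trans (le_abs_self r)
  have ha := norm_add_le y' (w - P n w)
  have hyz := norm_add_le y z
  have hn1 := norm_nonneg y
  have hn2 := norm_nonneg z
  have b1 := hδu ‖y + z‖ ‖y' + (w - P n w)‖ (norm_nonneg _) (by linarith) (norm_nonneg _)
    (by linarith) (by linarith)
  have b2 := hδu ‖y'‖ ‖y‖ (norm_nonneg _) (by linarith) (norm_nonneg _)
    (by linarith) (by linarith)
  have b3 := hδu ‖w - P n w‖ ‖z‖ (norm_nonneg _) (by linarith) (norm_nonneg _)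
    (by linarith) (by linarith)
  linarith

end

/-- Bounded real functions on `ι`. -/
abbrev Linf (ι : Type*) := lp (fun _ : ι => ℝ) ⊤

section

variable {ι : Type*} {p q : ℝ}

lemma Linf.abs_le_norm (φ : Linf ι) (i : ι) : |φ i| ≤ ‖φ‖ :=
  lp.norm_apply_le_norm ENNReal.top_ne_zero φ i

lemma Linf.norm_le {φ : Linf ι} {C : ℝ} (hC : 0 ≤ C) (h : ∀ i, |φ i| ≤ C) : ‖φ‖ ≤ C :=
  lp.norm_le_of_forall_le hC h

/-- A bounded function as an element of `Linf`. -/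
def Linf.mk (f : ι → ℝ) (C : ℝ) (h : ∀ i, |f i| ≤ C) : Linf ι :=
  ⟨f, memℓp_infty ⟨C, by rintro _ ⟨i, rfl⟩; exact h i⟩⟩

@[simp]
lemma Linf.mk_apply (f : ι → ℝ) (C : ℝ) (h : ∀ i, |f i| ≤ C) (i : ι) : Linf.mk f C h i = f i := rfl

/-- Composition with `σ` followed by multiplication by the contractive weight `w`. -/
noncomputable def Linf.wcomp (w : ι → ℝ) (hw : ∀ i, |w i| ≤ 1) (σ : ι → ι) : Linf ι →L[ℝ] Linf ι :=
  LinearMap.mkContinuous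
    { toFun := fun φ => Linf.mk (fun i => w i * φ (σ i)) ‖φ‖ fun i => by
        rw [abs_mul]
        nlinarith [hw i, Linf.abs_le_norm φ (σ i), abs_nonneg (w i), abs_nonneg (φ (σ i))]
      map_add' := fun φ ψ => lp.ext <| funext fun i => by simp [mul_add]
      map_smul' := fun c φ => lp.ext <| funext fun i => by simp [mul_left_comm] } 1 fun φ => by
    rw [one_mul]
    refine Linf.norm_le (norm_nonneg _) fun i => ?_
    simp only [LinearMap.coe_mk, AddHom.coe_mk, Linf.mk_apply, abs_mul]
    nlinarith [hw i, Linf.abs_le_norm φ (σ i), abs_nonneg (w i), abs_nonneg (φ (σ i))]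

@[simp]
lemma Linf.wcomp_apply (w : ι → ℝ) (hw : ∀ i, |w i| ≤ 1) (σ : ι → ι) (φ : Linf ι) (i : ι) :
    Linf.wcomp w hw σ φ i = w i * φ (σ i) := rfl

lemma Linf.norm_wcomp_le (w : ι → ℝ) (hw : ∀ i, |w i| ≤ 1) (σ : ι → ι) (φ : Linf ι) :
    ‖Linf.wcomp w hw σ φ‖ ≤ ‖φ‖ := by
  refine Linf.norm_le (norm_nonneg _) fun i => ?_
  rw [Linf.wcomp_apply, abs_mul]
  nlinarith [hw i, Linf.abs_le_norm φ (σ i), abs_nonneg (w i), abs_nonneg (φ (σ i))]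

lemma holder_two (hpq : p.HolderConjugate q) {α β A B : ℝ} (hα : 0 ≤ α) (hβ : 0 ≤ β)
    (hA : 0 ≤ A) (hB : 0 ≤ B) (h : α ^ q + β ^ q ≤ 1) : (α * A + β * B) ^ p ≤ A ^ p + B ^ p := by
  have hp0 : 0 < p := by linarith [hpq.lt]
  have hq0 : 0 < q := by linarith [hpq.symm.lt]
  have h1 := Real.inner_le_Lp_mul_Lq_of_nonneg (Finset.univ : Finset (Fin 2)) hpq
    (f := ![A, B]) (g := ![α, β]) (by simp [Fin.forall_fin_two, hA, hB])
    (by simp [Fin.forall_fin_two, hα, hβ])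
  simp only [Fin.sum_univ_two, Matrix.cons_val_zero, Matrix.cons_val_one] at h1
  have h2 : (α ^ q + β ^ q) ^ (1 / q) ≤ 1 :=
    Real.rpow_le_one (by positivity) h (by positivity)
  have h3 : 0 ≤ (A ^ p + B ^ p) ^ (1 / p) := by positivity
  have h4 : α * A + β * B ≤ (A ^ p + B ^ p) ^ (1 / p) := by nlinarith
  calc (α * A + β * B) ^ p ≤ ((A ^ p + B ^ p) ^ (1 / p)) ^ p :=
        Real.rpow_le_rpow (by positivity) h4 hp0.le
    _ = _ := by rw [← Real.rpow_mul (by positivity), one_div_mul_cancel hp0.ne', Real.rpow_one]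

lemma Linf.norm_add_rpow_le (hpq : p.HolderConjugate q) {u v : Linf ι}
    (h : ∀ i, ∃ α ≥ 0, ∃ β ≥ 0, α ^ q + β ^ q ≤ 1 ∧ |u i| ≤ α * ‖u‖ ∧ |v i| ≤ β * ‖v‖) :
    ‖u + v‖ ^ p ≤ ‖u‖ ^ p + ‖v‖ ^ p := by
  have hp0 : 0 < p := by linarith [hpq.lt]
  have h1 : ‖u + v‖ ≤ (‖u‖ ^ p + ‖v‖ ^ p) ^ (1 / p) := by
    refine Linf.norm_le (by positivity) fun i => ?_
    obtain ⟨α, hα, β, hβ, hαβ, hu, hv⟩ := h i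
    rw [one_div, Real.le_rpow_inv_iff_of_pos (abs_nonneg _) (by positivity) hp0]
    refine le_trans ?_ (holder_two hpq hα hβ (norm_nonneg u) (norm_nonneg v) hαβ)
    refine Real.rpow_le_rpow (abs_nonneg _) ?_ hp0.le
    exact (abs_add_le _ _).trans (add_le_add hu hv)
  rwa [one_div, Real.le_rpow_inv_iff_of_pos (norm_nonneg _) (by positivity) hp0] at h1

end

section Levels

/-- The largest `m ≤ k` such that the first `m` entries of `a` are below `k`. -/
def stopLevel (k : ℕ) (a : ℕ → ℕ) : ℕ := Nat.findGreatest (fun m => ∀ i < m, a i < k) k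

lemma le_stopLevel {k j : ℕ} {a : ℕ → ℕ} : j ≤ stopLevel k a ↔ j ≤ k ∧ ∀ i < j, a i < k := by
  constructor
  · intro h
    refine ⟨h.trans (Nat.findGreatest_le k), fun i hi => ?_⟩
    exact Nat.findGreatest_spec (P := fun m => ∀ i < m, a i < k) (Nat.zero_le k)
      (by simp) i (hi.trans_le h)
  · rintro ⟨h1, h2⟩
    exact Nat.le_findGreatest h1 h2

lemma stopLevel_mono {k j : ℕ} (h : k ≤ j) (a : ℕ → ℕ) : stopLevel k a ≤ stopLevel j a := by
  have := le_stopLevel.1 (le_refl (stopLevel k a))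
  exact le_stopLevel.2 ⟨this.1.trans h, fun i hi => (this.2 i hi).trans_le h⟩

lemma min_stopLevel_congr {k n : ℕ} {a b : ℕ → ℕ} (h : ∀ i < n, a i = b i) :
    min n (stopLevel k a) = min n (stopLevel k b) := by
  refine eq_of_forall_le_iff fun j => ?_
  simp only [le_min_iff, le_stopLevel]
  refine and_congr_right fun hj => and_congr_right fun _ => ?_
  exact forall₂_congr fun i hi => by rw [h i (hi.trans_le hj)]

end Levels

section BranchSpace

variable (γ : ℕ → ℝ) (q : ℝ)

/-- Total weight of the labels of a branch between two levels. -/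
def segSum (a : ℕ → ℕ) (m n : ℕ) : ℝ := ∑ i ∈ Finset.Ico m n, γ (a i)

variable {γ q}

lemma segSum_nonneg (hγ : ∀ l, 0 < γ l) (a : ℕ → ℕ) (m n : ℕ) : 0 ≤ segSum γ a m n :=
  Finset.sum_nonneg fun _ _ => (hγ _).le

lemma segSum_pos (hγ : ∀ l, 0 < γ l) (a : ℕ → ℕ) {m n : ℕ} (h : m < n) : 0 < segSum γ a m n :=
  Finset.sum_pos (fun _ _ => hγ _) (Finset.nonempty_Ico.2 h)

lemma segSum_of_le (a : ℕ → ℕ) {m n : ℕ} (h : n ≤ m) : segSum γ a m n = 0 := by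
  simp [segSum, Finset.Ico_eq_empty_of_le h]

lemma segSum_add (a : ℕ → ℕ) {l m n : ℕ} (h1 : l ≤ m) (h2 : m ≤ n) :
    segSum γ a l m + segSum γ a m n = segSum γ a l n :=
  Finset.sum_Ico_consecutive _ h1 h2

lemma segSum_congr {a b : ℕ → ℕ} {m n : ℕ} (h : ∀ i < n, a i = b i) :
    segSum γ a m n = segSum γ b m n :=
  Finset.sum_congr rfl fun i hi => by rw [h i (Finset.mem_Ico.1 hi).2]

lemma segSum_min_add_max (a : ℕ → ℕ) {m n : ℕ} (h : m ≤ n) (κ : ℕ) :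
    segSum γ a (min m κ) (min n κ) + segSum γ a (max m κ) (max n κ) = segSum γ a m n := by
  rcases le_total κ m with h1 | h1
  · rw [min_eq_right h1, min_eq_right (h1.trans h), max_eq_left h1, max_eq_left (h1.trans h),
      segSum_of_le a le_rfl, zero_add]
  rcases le_total n κ with h2 | h2
  · rw [min_eq_left h1, min_eq_left h2, max_eq_right h1, max_eq_right h2,
      segSum_of_le a le_rfl, add_zero]
  · rw [min_eq_left h1, min_eq_right h2, max_eq_right h1, max_eq_left h2, segSum_add a h1 h2]

lemma segSum_min_le (hγ : ∀ l, 0 < γ l) (a : ℕ → ℕ) (m n κ : ℕ) :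
    segSum γ a (min m κ) (min n κ) ≤ segSum γ a m n := by
  rcases le_total m n with h | h
  · linarith [segSum_min_add_max (γ := γ) a h κ, segSum_nonneg hγ a (max m κ) (max n κ)]
  · rw [segSum_of_le a h, segSum_of_le a (min_le_min_right κ h)]

/-- Finite segments of branches, given by a branch and two levels. -/
abbrev Seg := (ℕ → ℕ) × ℕ × ℕ

variable (γ q)

/-- The weight of a segment. -/
noncomputable def segWt (s : Seg) : ℝ := segSum γ s.1 s.2.1 s.2.2 ^ (1 / q)

variable {γ q}

lemma segWt_nonneg (hγ : ∀ l, 0 < γ l) (s : Seg) : 0 ≤ segWt γ q s :=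
  Real.rpow_nonneg (segSum_nonneg hγ _ _ _) _

lemma segWt_pos (hγ : ∀ l, 0 < γ l) (a : ℕ → ℕ) {m n : ℕ} (h : m < n) :
    0 < segWt γ q (a, m, n) := Real.rpow_pos_of_pos (segSum_pos hγ a h) _

lemma segWt_of_le (hq : 0 < q) (a : ℕ → ℕ) {m n : ℕ} (h : n ≤ m) : segWt γ q (a, m, n) = 0 := by
  rw [segWt, segSum_of_le _ h, Real.zero_rpow (by positivity)]

/-- The part of a segment below the stopping level. -/
def Seg.trunc (k : ℕ) (s : Seg) : Seg :=
  (s.1, min s.2.1 (stopLevel k s.1), min s.2.2 (stopLevel k s.1))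

lemma Seg.trunc_trunc {k j : ℕ} (h : k ≤ j) (s : Seg) : (s.trunc j).trunc k = s.trunc k := by
  have := stopLevel_mono h s.1
  simp only [Seg.trunc, min_assoc, min_eq_right this]

lemma segWt_trunc_le (hγ : ∀ l, 0 < γ l) (hq : 0 < q) (k : ℕ) (s : Seg) :
    segWt γ q (s.trunc k) ≤ segWt γ q s :=
  Real.rpow_le_rpow (segSum_nonneg hγ _ _ _) (segSum_min_le hγ _ _ _ _) (by positivity)

lemma abs_segWt_div_le (hγ : ∀ l, 0 < γ l) (hq : 0 < q) (k : ℕ) (s : Seg) :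
    |segWt γ q (s.trunc k) / segWt γ q s| ≤ 1 := by
  rw [abs_of_nonneg (div_nonneg (segWt_nonneg hγ _) (segWt_nonneg hγ _))]
  exact div_le_one_of_le₀ (segWt_trunc_le hγ hq k s) (segWt_nonneg hγ _)

/-- The projection truncating at the stopping level. -/
noncomputable def branchProj (hγ : ∀ l, 0 < γ l) (hq : 0 < q) (k : ℕ) : Linf Seg →L[ℝ] Linf Seg :=
  Linf.wcomp (fun s => segWt γ q (s.trunc k) / segWt γ q s) (abs_segWt_div_le hγ hq k) (Seg.trunc k)

lemma branchProj_mul (hγ : ∀ l, 0 < γ l) (hq : 0 < q) (k : ℕ) (φ : Linf Seg) (s : Seg) :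
    branchProj hγ hq k φ s * segWt γ q s = φ (s.trunc k) * segWt γ q (s.trunc k) := by
  rw [branchProj, Linf.wcomp_apply]
  rcases eq_or_ne (segWt γ q s) 0 with h | h
  · have : segWt γ q (s.trunc k) = 0 :=
      le_antisymm ((segWt_trunc_le hγ hq k s).trans h.le) (segWt_nonneg hγ _)
    rw [h, this]; simp
  · field_simp

variable (γ q)

/-- Adapted additive functions on segments, normalised by the segment weights. -/
noncomputable def branchAdapted : Submodule ℝ (Linf Seg) where
  carrier := {φ | (∀ a b m n, (∀ i < n, a i = b i) → φ (a, m, n) = φ (b, m, n)) ∧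
    (∀ a m n, n ≤ m → φ (a, m, n) = 0) ∧
    ∀ a l m n, l ≤ m → m ≤ n → φ (a, l, n) * segWt γ q (a, l, n) =
      φ (a, l, m) * segWt γ q (a, l, m) + φ (a, m, n) * segWt γ q (a, m, n)}
  zero_mem' := by simp
  add_mem' := by
    rintro φ ψ ⟨h1, h2, h3⟩ ⟨k1, k2, k3⟩
    refine ⟨fun a b m n h => ?_, fun a m n h => ?_, fun a l m n h h' => ?_⟩
    · simp [h1 a b m n h, k1 a b m n h]
    · simp [h2 a m n h, k2 a m n h]
    · simp only [lp.coeFn_add, Pi.add_apply]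
      linear_combination h3 a l m n h h' + k3 a l m n h h'
  smul_mem' := by
    rintro c φ ⟨h1, h2, h3⟩
    refine ⟨fun a b m n h => ?_, fun a m n h => ?_, fun a l m n h h' => ?_⟩
    · simp [h1 a b m n h]
    · simp [h2 a m n h]
    · simp only [lp.coeFn_smul, Pi.smul_apply, smul_eq_mul]
      linear_combination c * h3 a l m n h h'

/-- The functions determined by the labels before the stopping level. -/
noncomputable def branchLevel (k : ℕ) : Submodule ℝ (Linf Seg) where
  carrier := {φ | φ ∈ branchAdapted γ q ∧
    ∀ s, φ s * segWt γ q s = φ (Seg.trunc k s) * segWt γ q (Seg.trunc k s)}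
  zero_mem' := ⟨Submodule.zero_mem _, by simp⟩
  add_mem' := by
    rintro φ ψ ⟨h1, h2⟩ ⟨k1, k2⟩
    refine ⟨Submodule.add_mem _ h1 k1, fun s => ?_⟩
    simp only [lp.coeFn_add, Pi.add_apply]
    linear_combination h2 s + k2 s
  smul_mem' := by
    rintro c φ ⟨h1, h2⟩
    refine ⟨Submodule.smul_mem _ _ h1, fun s => ?_⟩
    simp only [lp.coeFn_smul, Pi.smul_apply, smul_eq_mul]
    linear_combination c * h2 s

variable {γ q}

lemma branchLevel_mono : Monotone (branchLevel γ q) := by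
  rintro k j hkj φ ⟨h1, h2⟩
  refine ⟨h1, fun s => ?_⟩
  rw [h2 s, h2 (s.trunc j), Seg.trunc_trunc hkj]

lemma branchProj_mem (hγ : ∀ l, 0 < γ l) (hq : 0 < q) (k : ℕ) {φ : Linf Seg}
    (h : φ ∈ branchAdapted γ q) : branchProj hγ hq k φ ∈ branchLevel γ q k := by
  obtain ⟨h1, h2, h3⟩ := h
  have hzero : ∀ a m n, n ≤ m → branchProj hγ hq k φ (a, m, n) = 0 := by
    intro a m n h
    rw [branchProj, Linf.wcomp_apply, Seg.trunc, h2 _ _ _ (min_le_min_right _ h), mul_zero]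
  refine ⟨⟨fun a b m n h => ?_, hzero, fun a l m n hl hm => ?_⟩, fun s => ?_⟩
  · rcases le_total n m with hnm | hmn
    · rw [hzero _ _ _ hnm, hzero _ _ _ hnm]
    · have e1 : segWt γ q (Seg.trunc k (a, m, n)) = segWt γ q (Seg.trunc k (b, m, n)) := by
        simp only [segWt, Seg.trunc]
        rw [min_stopLevel_congr h, min_stopLevel_congr fun i hi => h i (hi.trans_le hmn),
          segSum_congr fun i hi => h i (hi.trans_le (min_le_left _ _))]
      have e2 : segWt γ q (a, m, n) = segWt γ q (b, m, n) := by
        simp only [segWt]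
        rw [segSum_congr h]
      have e3 : φ (Seg.trunc k (a, m, n)) = φ (Seg.trunc k (b, m, n)) := by
        simp only [Seg.trunc]
        rw [min_stopLevel_congr h, min_stopLevel_congr fun i hi => h i (hi.trans_le hmn),
          h1 a b _ _ fun i hi => h i (hi.trans_le (min_le_left _ _))]
      simp only [branchProj, Linf.wcomp_apply, e1, e2, e3]
  · simp only [branchProj_mul]
    exact h3 a _ _ _ (min_le_min_right _ hl) (min_le_min_right _ hm)
  · simp only [branchProj_mul, Seg.trunc_trunc le_rfl]

lemma finiteDimensional_branchLevel (hγ : ∀ l, 0 < γ l) (k : ℕ) :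
    FiniteDimensional ℝ (branchLevel γ q k) := by
  let ext : (Fin k → Fin k) → ℕ → ℕ := fun s i => if h : i < k then s ⟨i, h⟩ else 0
  let ev : branchLevel γ q k →ₗ[ℝ] ((Fin k → Fin k) × Fin (k + 1) × Fin (k + 1) → ℝ) :=
    { toFun := fun φ t => φ.1 (ext t.1, t.2.1, t.2.2)
      map_add' := fun φ ψ => rfl
      map_smul' := fun c φ => rfl }
  refine Module.Finite.of_injective ev ?_
  rw [← LinearMap.ker_eq_bot, LinearMap.ker_eq_bot']
  rintro ⟨φ, hφ⟩ h0
  refine Subtype.ext (lp.ext (funext ?_))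
  rintro ⟨a, m, n⟩
  change φ (a, m, n) = 0
  rcases le_or_gt n m with hnm | hmn
  · exact hφ.1.2.1 a m n hnm
  have hs := le_stopLevel.1 (le_refl (stopLevel k a))
  have hzero : φ (Seg.trunc k (a, m, n)) = 0 := by
    rcases Nat.eq_zero_or_pos k with rfl | hk
    · refine hφ.1.2.1 _ _ _ ?_
      have : stopLevel 0 a = 0 := Nat.le_zero.1 hs.1
      simp [this]
    let t : Fin k → Fin k := fun i => if h : a i < k then ⟨a i, h⟩ else ⟨0, hk⟩
    have h1 : φ (Seg.trunc k (a, m, n)) = φ (ext t, (Seg.trunc k (a, m, n)).2) := by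
      refine hφ.1.1 _ _ _ _ fun i hi => ?_
      have hi' : i < stopLevel k a := hi.trans_le (min_le_right _ _)
      have hik : i < k := hi'.trans_le hs.1
      simp [ext, t, hik, hs.2 i hi']
    rw [h1]
    have := congrFun h0 (t,
      ⟨min m (stopLevel k a), Nat.lt_succ_of_le ((min_le_right _ _).trans hs.1)⟩,
      ⟨min n (stopLevel k a), Nat.lt_succ_of_le ((min_le_right _ _).trans hs.1)⟩)
    exact this
  have h2 := hφ.2 (a, m, n)
  rw [hzero, zero_mul] at h2
  exact (mul_eq_zero.1 h2).resolve_right (segWt_pos hγ a hmn).ne'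

lemma branch_estimate {p : ℝ} (hpq : p.HolderConjugate q) (hγ : ∀ l, 0 < γ l) (hq : 0 < q) (k : ℕ)
    {u v : Linf Seg} (hu : u ∈ branchLevel γ q k) (hv : v ∈ branchAdapted γ q) :
    ‖u + (v - branchProj hγ hq k v)‖ ^ p ≤ ‖u‖ ^ p + ‖v - branchProj hγ hq k v‖ ^ p := by
  set w := v - branchProj hγ hq k v with hw
  have hPv := (branchProj_mem hγ hq k hv).1
  have hwA : w ∈ branchAdapted γ q := Submodule.sub_mem _ hv hPv
  have hwmul : ∀ s, w s * segWt γ q s =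
      v s * segWt γ q s - v (s.trunc k) * segWt γ q (s.trunc k) := by
    intro s
    rw [← branchProj_mul hγ hq k v s, ← sub_mul]
    rfl
  refine Linf.norm_add_rpow_le hpq ?_
  rintro ⟨a, m, n⟩
  rcases le_or_gt n m with hnm | hmn
  · refine ⟨0, le_rfl, 0, le_rfl, ?_, ?_, ?_⟩
    · rw [Real.zero_rpow hq.ne']; norm_num
    · rw [hu.1.2.1 a m n hnm]; simp
    · rw [hwA.2.1 a m n hnm]; simp
  set κ := stopLevel k a with hκ
  have hg := segWt_pos (q := q) hγ a hmn
  have hgs := segSum_pos hγ a hmn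
  have bound : ∀ (f : Linf Seg) (s : Seg),
      f (a, m, n) * segWt γ q (a, m, n) = f s * segWt γ q s →
      |f (a, m, n)| ≤ segWt γ q s / segWt γ q (a, m, n) * ‖f‖ := by
    intro f s h
    have : f (a, m, n) = segWt γ q s / segWt γ q (a, m, n) * f s := by
      field_simp; linarith
    rw [this, abs_mul, abs_of_nonneg (div_nonneg (segWt_nonneg hγ _) hg.le)]
    exact mul_le_mul_of_nonneg_left (Linf.abs_le_norm _ _)
      (div_nonneg (segWt_nonneg hγ _) hg.le)
  refine ⟨segWt γ q (a, min m κ, min n κ) / segWt γ q (a, m, n),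
    div_nonneg (segWt_nonneg hγ _) hg.le,
    segWt γ q (a, max m κ, max n κ) / segWt γ q (a, m, n),
    div_nonneg (segWt_nonneg hγ _) hg.le, ?_, bound u _ (hu.2 _), bound w _ ?_⟩
  · rw [Real.div_rpow (segWt_nonneg hγ _) hg.le, Real.div_rpow (segWt_nonneg hγ _) hg.le, ← add_div]
    have e : ∀ s : Seg, segWt γ q s ^ q = segSum γ s.1 s.2.1 s.2.2 := fun s => by
      rw [segWt, ← Real.rpow_mul (segSum_nonneg hγ _ _ _), one_div_mul_cancel hq.ne', Real.rpow_one]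
    rw [e, e, e, segSum_min_add_max a hmn.le, div_self hgs.ne']
  · rw [hwmul, hwmul]
    simp only [Seg.trunc, ← hκ]
    have e1 : min (max m κ) κ = κ := min_eq_right (le_max_right _ _)
    have e2 : min (max n κ) κ = κ := min_eq_right (le_max_right _ _)
    rw [e1, e2, segWt_of_le hq a (le_refl κ), mul_zero, sub_zero]
    rcases le_total κ m with h1 | h1
    · rw [min_eq_right h1, min_eq_right (h1.trans hmn.le), max_eq_left h1,
        max_eq_left (h1.trans hmn.le), segWt_of_le hq a (le_refl κ), mul_zero, sub_zero]
    rcases le_total n κ with h2 | h2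
    · rw [min_eq_left h1, min_eq_left h2, max_eq_right h1, max_eq_right h2,
        segWt_of_le hq a (le_refl κ), mul_zero, sub_self]
    · rw [min_eq_left h1, min_eq_right h2, max_eq_right h1, max_eq_left h2,
        hv.2.2 a m κ n h1 h2]
      ring

variable (γ q)

/-- The space containing all `p`-AUS-able separable spaces. -/
noncomputable abbrev BranchSpace : Submodule ℝ (Linf Seg) :=
  (⨆ k, branchLevel γ q k).topologicalClosure

variable {γ q}

lemma separableSpace_branchSpace (hγ : ∀ l, 0 < γ l) :
    TopologicalSpace.SeparableSpace (BranchSpace γ q) := by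
  have := finiteDimensional_branchLevel (q := q) hγ
  exact separableSpace_closure _ branchLevel_mono

lemma weakUpper_branchSpace {p : ℝ} (hpq : p.HolderConjugate q) (hγ : ∀ l, 0 < γ l) :
    WeakUpper p (BranchSpace γ q) := by
  have := finiteDimensional_branchLevel (q := q) hγ
  have hq : 0 < q := by linarith [hpq.symm.lt]
  exact weakUpper_closure _ hpq.lt branchLevel_mono (branchProj hγ hq)
    (fun k v => Linf.norm_wcomp_le _ _ _ v)
    (fun k j u hu => branchProj_mem hγ hq k hu.1)
    (fun k j u hu v hv => branch_estimate hpq hγ hq k hu hv.1)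

end BranchSpace

section LastTrue

open Classical in
/-- The last index up to `n` at which a predicate holds. -/
noncomputable def lastTrue (A : ℕ → Prop) (n : ℕ) : ℕ := Nat.findGreatest A n

variable {A : ℕ → Prop}

lemma le_lastTrue (h0 : A 0) (hA : ∀ m n, m ≤ n → A n → A m) {j n : ℕ} :
    j ≤ lastTrue A n ↔ j ≤ n ∧ A j := by
  classical
  constructor
  · intro h
    exact ⟨h.trans (Nat.findGreatest_le n), hA _ _ h (Nat.findGreatest_spec (Nat.zero_le n) h0)⟩
  · rintro ⟨h1, h2⟩
    exact Nat.le_findGreatest h1 h2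

lemma lastTrue_spec (h0 : A 0) (hA : ∀ m n, m ≤ n → A n → A m) (n : ℕ) : A (lastTrue A n) :=
  ((le_lastTrue h0 hA).1 le_rfl).2

lemma lastTrue_le (n : ℕ) : lastTrue A n ≤ n := by
  classical exact Nat.findGreatest_le n

lemma lastTrue_eq_self {n : ℕ} (h : A n) : lastTrue A n = n := by
  classical exact le_antisymm (Nat.findGreatest_le n) (Nat.le_findGreatest le_rfl h)

lemma lastTrue_eq_or (h0 : A 0) (hA : ∀ m n, m ≤ n → A n → A m) {m n : ℕ} (hmn : m ≤ n) :
    lastTrue A n = lastTrue A m ∨ (lastTrue A m = m ∧ m < lastTrue A n) := by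
  have hle : lastTrue A m ≤ lastTrue A n :=
    (le_lastTrue h0 hA).2 ⟨(lastTrue_le m).trans hmn, lastTrue_spec h0 hA m⟩
  rcases hle.eq_or_lt with h | h
  · exact Or.inl h.symm
  · refine Or.inr ?_
    have hm : ¬ lastTrue A m < m := fun hlt => by
      have := (le_lastTrue h0 hA (j := lastTrue A m + 1) (n := m)).2
        ⟨hlt, ((le_lastTrue h0 hA).1 (Nat.succ_le_of_lt h)).2⟩
      omega
    have := lastTrue_le (A := A) m
    omega

lemma lastTrue_congr {B : ℕ → Prop} {n : ℕ} (h : ∀ m ≤ n, A m ↔ B m) :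
    lastTrue A n = lastTrue B n := by
  classical
  induction n with
  | zero => simp [lastTrue]
  | succ n ih =>
    have ih := ih fun m hm => h m (hm.trans n.le_succ)
    unfold lastTrue at *
    rw [Nat.findGreatest_succ, Nat.findGreatest_succ, ih]
    simp only [h (n + 1) le_rfl]

end LastTrue

section Labels

/-- The positive weight coded by a label. -/
noncomputable def labelWt (l : ℕ) : ℝ := (l.unpair.2.unpair.1 + 1 : ℝ) / (l.unpair.2.unpair.2 + 1)

lemma labelWt_pos (l : ℕ) : 0 < labelWt l := by unfold labelWt; positivity

lemma exists_label (k : ℕ) {Γ ε : ℝ} (hΓ : 0 < Γ) (hε : 0 < ε) :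
    ∃ l : ℕ, l.unpair.1 = k ∧ Γ ≤ labelWt l ∧ labelWt l ≤ Γ + ε := by
  obtain ⟨r, hr1, hr2⟩ := exists_rat_btwn (show Γ < Γ + ε by linarith)
  have hr0 : 0 < r := by exact_mod_cast hΓ.trans hr1
  have hnum : 0 < r.num := Rat.num_pos.2 hr0
  refine ⟨Nat.pair k (Nat.pair (r.num.toNat - 1) (r.den - 1)), by simp, ?_⟩
  have e : labelWt (Nat.pair k (Nat.pair (r.num.toNat - 1) (r.den - 1))) = r := by
    simp only [labelWt, Nat.unpair_pair]
    have h1 : ((r.num.toNat - 1 : ℕ) : ℝ) + 1 = r.num := by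
      have h : r.num.toNat - 1 + 1 = r.num.toNat := by omega
      have h' : ((r.num.toNat : ℕ) : ℤ) = r.num := Int.toNat_of_nonneg hnum.le
      calc ((r.num.toNat - 1 : ℕ) : ℝ) + 1 = ((r.num.toNat - 1 + 1 : ℕ) : ℝ) := by push_cast; rfl
        _ = ((r.num.toNat : ℤ) : ℝ) := by rw [h]; rfl
        _ = r.num := by rw [h']
    have h2 : ((r.den - 1 : ℕ) : ℝ) + 1 = r.den := by
      have h : r.den - 1 + 1 = r.den := Nat.succ_pred_eq_of_pos r.den_pos
      exact_mod_cast h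
    rw [h1, h2]
    exact_mod_cast r.num_div_den
  rw [e]
  exact ⟨hr1.le, hr2.le⟩

end Labels

section

variable {X : Type*} [NormedAddCommGroup X] [NormedSpace ℝ X] {q : ℝ} {γ : ℕ → ℝ}

lemma isomToClosedSubspace_branchSpace (hγ : ∀ l, 0 < γ l) (hq : 0 < q)
    (D : (ℕ → ℕ) → ℕ → StrongDual ℝ X) (hadapt : ∀ a b n, (∀ i < n, a i = b i) → D a n = D b n)
    (hnorm : ∀ a m n, m < n → ‖D a n - D a m‖ ≤ segWt γ q (a, m, n))
    {S : Set X} (hS : Dense S) {c : ℝ} (hc : 0 < c)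
    (hlow : ∀ x ∈ S, ∀ r < ‖x‖, ∃ a m n, m < n ∧ c * r * segWt γ q (a, m, n) ≤ |(D a n - D a m) x|)
    (happ : ∀ x ∈ S, ∀ ε > 0, ∃ k, ∀ a m n, m < n →
      |(D a n - D a m) x - (D a (min n (stopLevel k a)) - D a (min m (stopLevel k a))) x| ≤
        ε * segWt γ q (a, m, n)) :
    IsomToClosedSubspace X (BranchSpace γ q) := by
  have hb : ∀ x (s : Seg), |(D s.1 s.2.2 - D s.1 s.2.1) x / segWt γ q s| ≤ ‖x‖ := by
    rintro x ⟨a, m, n⟩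
    rcases le_or_gt n m with h | h
    · rw [segWt_of_le hq a h]; simp
    · rw [abs_div, abs_of_nonneg (segWt_nonneg hγ _), div_le_iff₀ (segWt_pos hγ a h), mul_comm]
      exact ((D a n - D a m).le_opNorm x).trans
        (mul_le_mul_of_nonneg_right (hnorm a m n h) (norm_nonneg x))
  let J : X →L[ℝ] Linf Seg := LinearMap.mkContinuous
    { toFun := fun x => Linf.mk (fun s => (D s.1 s.2.2 - D s.1 s.2.1) x / segWt γ q s) ‖x‖ (hb x)
      map_add' := fun x y => lp.ext <| funext fun s => by
        simp only [map_add, Linf.mk_apply, lp.coeFn_add, Pi.add_apply]; ring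
      map_smul' := fun r x => lp.ext <| funext fun s => by
        simp only [map_smul, Linf.mk_apply, lp.coeFn_smul, Pi.smul_apply, smul_eq_mul,
          RingHom.id_apply]; ring } 1 fun x => by
    rw [one_mul]
    exact Linf.norm_le (norm_nonneg x) (hb x)
  have hJ : ∀ x s, J x s = (D s.1 s.2.2 - D s.1 s.2.1) x / segWt γ q s := fun _ _ => rfl
  have hJmul : ∀ x a m n, m ≤ n →
      J x (a, m, n) * segWt γ q (a, m, n) = (D a n - D a m) x := by
    intro x a m n h
    rcases h.eq_or_lt with rfl | h
    · rw [segWt_of_le hq a le_rfl]; simp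
    · rw [hJ]
      exact div_mul_cancel₀ _ (segWt_pos hγ a h).ne'
  have hJA : ∀ x, J x ∈ branchAdapted γ q := by
    intro x
    refine ⟨fun a b m n h => ?_, fun a m n h => ?_, fun a l m n h1 h2 => ?_⟩
    · rcases le_or_gt n m with hnm | hmn
      · rw [hJ, hJ, segWt_of_le hq a hnm, segWt_of_le hq b hnm]; simp
      · rw [hJ, hJ]
        simp only [segWt]
        rw [segSum_congr h, hadapt a b n h, hadapt a b m fun i hi => h i (hi.trans hmn)]
    · rw [hJ, segWt_of_le hq a h, div_zero]
    · rw [hJmul x _ _ _ h1, hJmul x _ _ _ h2, hJmul x _ _ _ (h1.trans h2)]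
      simp
  have hJS : ∀ x ∈ S, J x ∈ BranchSpace γ q := by
    intro x hx
    refine Metric.mem_closure_iff.2 fun ε hε => ?_
    obtain ⟨k, hk⟩ := happ x hx (ε / 2) (by positivity)
    have hmem := branchProj_mem hγ hq k (hJA x)
    refine ⟨branchProj hγ hq k (J x), Submodule.mem_iSup_of_mem k hmem, ?_⟩
    rw [dist_eq_norm]
    refine (Linf.norm_le (C := ε / 2) (by positivity) ?_).trans_lt (by linarith)
    rintro ⟨a, m, n⟩
    rcases le_or_gt n m with hnm | hmn
    · rw [(Submodule.sub_mem _ (hJA x) hmem.1).2.1 a m n hnm]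
      rw [abs_zero]; positivity
    · have h0 := segWt_pos (q := q) hγ a hmn
      have h1 := branchProj_mul hγ hq k (J x) (a, m, n)
      rw [Seg.trunc, hJmul x _ _ _ (min_le_min_right _ hmn.le)] at h1
      have h2 := hJmul x a m n hmn.le
      have h3 := hk a m n hmn
      rw [← h1, ← h2, ← sub_mul, abs_mul, abs_of_pos h0] at h3
      exact le_of_mul_le_mul_right h3 h0
  have hJU : ∀ x, J x ∈ BranchSpace γ q := by
    intro x
    have hcl : IsClosed (J ⁻¹' (BranchSpace γ q : Set (Linf Seg))) :=
      (Submodule.isClosed_topologicalClosure _).preimage J.continuous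
    exact hcl.closure_subset_iff.2 hJS (hS x)
  have hJlow : ∀ x, c * ‖x‖ ≤ ‖J x‖ := by
    have hcl : IsClosed {x | c * ‖x‖ ≤ ‖J x‖} :=
      isClosed_le (continuous_const.mul continuous_norm) J.continuous.norm
    intro x
    refine hcl.closure_subset_iff.2 ?_ (hS x)
    intro x hx
    change c * ‖x‖ ≤ ‖J x‖
    rw [← le_div_iff₀' hc]
    refine le_of_forall_lt_imp_le_of_dense fun r hr => ?_
    obtain ⟨a, m, n, hmn, h⟩ := hlow x hx r hr
    rw [le_div_iff₀' hc]
    have h0 := segWt_pos (q := q) hγ a hmn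
    rw [← hJmul x a m n hmn.le, abs_mul, abs_of_pos h0] at h
    exact (le_of_mul_le_mul_right h h0).trans (Linf.abs_le_norm _ _)
  refine ⟨J.codRestrict _ hJU, fun x y hxy => ?_, c, hc, hJlow⟩
  have h : J (x - y) = 0 := by
    have : J x = J y := congrArg Subtype.val hxy
    rw [map_sub, this, sub_self]
  have h2 := hJlow (x - y)
  rw [h, norm_zero] at h2
  rw [← sub_eq_zero, ← norm_le_zero_iff]
  nlinarith [norm_nonneg (x - y)]

/-- Successively refined finite nets of the dual ball. -/
lemma exists_tower (V : ℕ → StrongDual ℝ X → Set (StrongDual ℝ X))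
    (hV : ∀ n S, V n S ∈ weakStarZero X) (hV0 : V 0 0 = univ) :
    ∃ F : ℕ → Finset (StrongDual ℝ X), F 0 = {0} ∧ (∀ n, ∀ S ∈ F n, ‖S‖ ≤ 1) ∧
      ∀ f : StrongDual ℝ X, ‖f‖ ≤ 1 → ∃ S : ℕ → StrongDual ℝ X, (∀ n, S n ∈ F n) ∧
        (∀ i j, i < j → S j - S i ∈ V i (S i)) ∧ ∀ n, f - S n ∈ V n (S n) := by
  classical
  have step : ∀ (n : ℕ) (Ω : {Ω : Set (StrongDual ℝ X) // Ω ∈ weakStarZero X}),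
      ∃ (F : Finset (StrongDual ℝ X)) (W : StrongDual ℝ X → Set (StrongDual ℝ X)),
        (∀ S ∈ F, ‖S‖ ≤ 1) ∧ (∀ S, W S ∈ weakStarZero X) ∧ (∀ S, W S ⊆ Ω.1) ∧
        (∀ S, ∀ g ∈ W S, ∀ h ∈ W S, g - h ∈ V n S) ∧
        ∀ f : StrongDual ℝ X, ‖f‖ ≤ 1 → ∃ S ∈ F, f - S ∈ W S := by
    intro n Ω
    have : ∀ S, ∃ t ∈ weakStarZero X, ∀ g ∈ t, ∀ h ∈ t, g - h ∈ V n S := fun S =>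
      exists_sub_mem (fun _ _ _ => rfl) (hV n S)
    choose t ht htV using this
    obtain ⟨F, hF1, hF⟩ := exists_finite_cover (fun S => t S ∩ Ω.1) fun S =>
      Filter.inter_mem (ht S) Ω.2
    exact ⟨F, fun S => t S ∩ Ω.1, hF1, fun S => Filter.inter_mem (ht S) Ω.2,
      fun S => inter_subset_right, fun S g hg h hh => htV S g hg.1 h hh.1, hF⟩
  choose F W hF1 hW hWΩ hWV hF using step
  let Ω : ℕ → {Ω : Set (StrongDual ℝ X) // Ω ∈ weakStarZero X} := fun n => Nat.rec
    ⟨univ, Filter.univ_mem⟩ (fun n Ω => ⟨Ω.1 ∩ ⋂ S ∈ F (n + 1) Ω, W (n + 1) Ω S,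
      Filter.inter_mem Ω.2 ((Filter.biInter_finset_mem _).2 fun S _ => hW _ _ S)⟩) n
  have hΩs : ∀ n, (Ω (n + 1)).1 = (Ω n).1 ∩ ⋂ S ∈ F (n + 1) (Ω n), W (n + 1) (Ω n) S :=
    fun n => rfl
  have hanti : Antitone fun n => (Ω n).1 :=
    antitone_nat_of_succ_le fun n => by rw [hΩs]; exact inter_subset_left
  let F' : ℕ → Finset (StrongDual ℝ X) := fun n => Nat.casesOn n {0} fun n => F (n + 1) (Ω n)
  refine ⟨F', rfl, fun n S hS => ?_, fun f hf => ?_⟩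
  · cases n with
    | zero => simp [Finset.mem_singleton.1 hS]
    | succ n => exact hF1 _ _ S hS
  · have : ∀ n, ∃ S ∈ F (n + 1) (Ω n), f - S ∈ W (n + 1) (Ω n) S := fun n => hF _ _ f hf
    choose T hTF hTW using this
    let S : ℕ → StrongDual ℝ X := fun n => Nat.casesOn n 0 T
    have h0 : ∀ n T, (0 : StrongDual ℝ X) ∈ W n (Ω (n - 1)) T := by
      intro n T
      obtain ⟨I, δ, hδ, h⟩ := hW n (Ω (n - 1)) T
      exact h 0 fun i _ => by simpa using hδ
    refine ⟨S, fun n => ?_, fun i j hij => ?_, fun n => ?_⟩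
    · cases n with
      | zero => exact Finset.mem_singleton_self 0
      | succ n => exact hTF n
    · cases i with
      | zero => change _ ∈ V 0 0; rw [hV0]; exact mem_univ _
      | succ i =>
        obtain ⟨j, rfl⟩ : ∃ k, j = k + 1 := ⟨j - 1, by omega⟩
        have h1 : f - T j ∈ W (i + 1) (Ω i) (T i) := by
          have h2 : f - T j ∈ (Ω (i + 1)).1 :=
            hanti (show i + 1 ≤ j by omega) (hWΩ _ _ _ (hTW j))
          rw [hΩs] at h2
          exact mem_iInter₂.1 h2.2 (T i) (hTF i)
        have h3 := hWV _ _ _ _ (hTW i) _ h1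
        rwa [sub_sub_sub_cancel_left] at h3
    · cases n with
      | zero => change _ ∈ V 0 0; rw [hV0]; exact mem_univ _
      | succ n =>
        have := hWV _ _ _ _ (hTW n) _ (h0 (n + 1) (T n))
        rwa [sub_zero] at this

end

section

lemma segSum_le_segSum {γ : ℕ → ℝ} (hγ : ∀ l, 0 < γ l) (a : ℕ → ℕ) {m n i j : ℕ} (h1 : m ≤ i)
    (h2 : j ≤ n) : segSum γ a i j ≤ segSum γ a m n :=
  Finset.sum_le_sum_of_subset_of_nonneg (Finset.Ico_subset_Ico h1 h2) fun _ _ _ => (hγ _).le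

lemma exists_decoder {α : Type*} [Inhabited α] (F : Finset α) :
    ∃ dec : ℕ → α, ∀ S ∈ F, ∃ l, dec l = S := by
  classical
  obtain ⟨dec, h⟩ := (insert default F).countable_toSet.exists_eq_range ⟨default, by simp⟩
  refine ⟨dec, fun S hS => ?_⟩
  have : S ∈ range dec := by rw [← h]; simp [hS]
  exact this

variable {X : Type*} [NormedAddCommGroup X] [NormedSpace ℝ X] {q : ℝ}

lemma isomToClosedSubspace_of_weakStarLower [TopologicalSpace.SeparableSpace X]
    (hq : 1 < q) (hX : WeakStarLower q X) :
    IsomToClosedSubspace X (BranchSpace labelWt q) := by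
  obtain ⟨c, hc, hc1, hcX⟩ : ∃ c > 0, c ≤ 1 ∧ ∀ (f : StrongDual ℝ X) (R ε : ℝ), 0 < ε →
      ∀ᶠ g in weakStarZero X, ‖g‖ ≤ R → ‖f‖ ^ q + c * ‖g‖ ^ q ≤ ‖f + g‖ ^ q + ε := by
    obtain ⟨c, hc, h⟩ := hX
    refine ⟨min c 1, by positivity, min_le_right _ _, fun f R ε hε => ?_⟩
    filter_upwards [h f R ε hε] with g hg hgR
    have := mul_le_mul_of_nonneg_right (min_le_left c 1) (Real.rpow_nonneg (norm_nonneg g) q)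
    linarith [hg hgR]
  have hq0 : 0 < q := by linarith
  let x : ℕ → X := TopologicalSpace.denseSeq X
  let e : ℕ → ℝ := fun n => (1 / 2) ^ n
  have he : ∀ n, 0 < e n := fun n => by positivity
  have hes : ∀ n, e n = 2 * e (n + 1) := fun n => by simp only [e, pow_succ]; ring
  have he1 : ∀ n, e n ≤ 1 := fun n => pow_le_one₀ (by norm_num) (by norm_num)
  have hanti : Antitone e := antitone_nat_of_succ_le fun n => by linarith [hes n, he (n + 1)]
  have helim : Tendsto e atTop (𝓝 0) :=
    tendsto_pow_atTop_nhds_zero_of_lt_one (by norm_num) (by norm_num)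
  let θ : ℕ → ℝ := fun n => e n * (e n / c) ^ (1 / q)
  have hθ : ∀ n, 0 < θ n := fun n => mul_pos (he n) (Real.rpow_pos_of_pos (div_pos (he n) hc) _)
  let V : ℕ → StrongDual ℝ X → Set (StrongDual ℝ X) := fun n S =>
    {g | (‖g‖ ≤ 2 → ‖S‖ ^ q + c * ‖g‖ ^ q ≤ ‖S + g‖ ^ q + e n) ∧ ∀ l < n, |g (x l)| ≤ θ n}
  have hV : ∀ n S, V n S ∈ weakStarZero X := by
    intro n S
    filter_upwards [hcX S 2 (e n) (he n), (Finset.eventually_all (Finset.range n)).2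
      fun l _ => weakStarZero_abs_lt (x l) (hθ n)] with g h1 h2
    exact ⟨h1, fun l hl => (h2 l (Finset.mem_range.2 hl)).le⟩
  have hV0 : V 0 0 = univ := by
    refine eq_univ_of_forall fun g => ⟨fun _ => ?_, fun l hl => absurd hl (Nat.not_lt_zero l)⟩
    rw [norm_zero, Real.zero_rpow hq0.ne', zero_add, zero_add]
    have := mul_le_mul_of_nonneg_right hc1 (Real.rpow_nonneg (norm_nonneg g) q)
    linarith [he 0]
  obtain ⟨F, hF0, hF1, hF⟩ := exists_tower V hV hV0
  have hVlow : ∀ i (S T : StrongDual ℝ X), ‖S‖ ≤ 1 → ‖T‖ ≤ 1 → T - S ∈ V i S →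
      ‖S‖ ^ q + c * ‖T - S‖ ^ q ≤ ‖T‖ ^ q + e i := by
    intro i S T hS hT h
    have := h.1 ((norm_sub_le _ _).trans (by linarith))
    rwa [add_sub_cancel] at this
  have hdec : ∀ j, ∃ dec : ℕ → StrongDual ℝ X, ∀ S ∈ F j, ∃ l, dec l = S :=
    fun j => exists_decoder (F j)
  choose dec hdec using hdec
  let Γ : ℕ → StrongDual ℝ X → StrongDual ℝ X → ℝ := fun j S T =>
    (‖T‖ ^ q - ‖S‖ ^ q + 2 * e j) / c
  have hlab : ∀ j S T, ∃ l : ℕ, T ∈ F (j + 1) → 0 < Γ j S T →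
      dec (j + 1) l.unpair.1 = T ∧ Γ j S T ≤ labelWt l ∧ labelWt l ≤ Γ j S T + e j := by
    intro j S T
    by_cases h : T ∈ F (j + 1) ∧ 0 < Γ j S T
    · obtain ⟨k, hk⟩ := hdec (j + 1) T h.1
      obtain ⟨l, h1, h2, h3⟩ := exists_label k h.2 (he j)
      exact ⟨l, fun _ _ => ⟨by rw [h1, hk], h2, h3⟩⟩
    · exact ⟨0, fun h1 h2 => absurd ⟨h1, h2⟩ h⟩
  choose lab hlab using hlab
  have hΓ : ∀ j S T, ‖S‖ ≤ 1 → ‖T‖ ≤ 1 → T - S ∈ V j S → 0 < Γ j S T := by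
    intro j S T hS hT h
    have h1 := hVlow j S T hS hT h
    have h2 := mul_nonneg hc.le (Real.rpow_nonneg (norm_nonneg (T - S)) q)
    exact div_pos (by linarith [he j]) hc
  let d : (ℕ → ℕ) → ℕ → StrongDual ℝ X := fun a n =>
    Nat.casesOn n 0 fun j => dec (j + 1) (a j).unpair.1
  let alive : (ℕ → ℕ) → ℕ → Prop := fun a m => (∀ j ≤ m, d a j ∈ F j) ∧
    (∀ j ≤ m, ∀ i < j, d a j - d a i ∈ V i (d a i)) ∧ ∀ j < m, a j = lab j (d a j) (d a (j + 1))
  have hd : ∀ a b n, (∀ i < n, a i = b i) → d a n = d b n := by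
    intro a b n h
    cases n with
    | zero => rfl
    | succ n => change dec _ _ = dec _ _; rw [h n n.lt_succ_self]
  have halive : ∀ a b n, (∀ i < n, a i = b i) → alive a n → alive b n := by
    rintro a b n h ⟨h1, h2, h3⟩
    have hd' : ∀ j ≤ n, d b j = d a j := fun j hj =>
      hd b a j fun i hi => (h i (hi.trans_le hj)).symm
    refine ⟨fun j hj => hd' j hj ▸ h1 j hj, fun j hj i hi => ?_, fun j hj => ?_⟩
    · rw [hd' j hj, hd' i (hi.le.trans hj)]
      exact h2 j hj i hi
    · rw [hd' j hj.le, hd' (j + 1) hj, ← h j hj]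
      exact h3 j hj
  have hmono : ∀ a m n, m ≤ n → alive a n → alive a m := fun a m n h hn =>
    ⟨fun j hj => hn.1 j (hj.trans h), fun j hj => hn.2.1 j (hj.trans h),
      fun j hj => hn.2.2 j (hj.trans_le h)⟩
  have h0 : ∀ a, alive a 0 := by
    refine fun a => ⟨fun j hj => ?_, fun j hj i hi => ?_, fun j hj => ?_⟩
    · rw [Nat.le_zero.1 hj, hF0]
      exact Finset.mem_singleton_self _
    · omega
    · omega
  let D : (ℕ → ℕ) → ℕ → StrongDual ℝ X := fun a n => d a (lastTrue (alive a) n)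
  have hstep : ∀ a m, alive a m → ∀ j < m, Γ j (d a j) (d a (j + 1)) ≤ labelWt (a j) ∧
      labelWt (a j) ≤ Γ j (d a j) (d a (j + 1)) + e j := by
    intro a m h j hj
    have h1 := h.1 j hj.le
    have h2 := h.1 (j + 1) hj
    have := hlab j (d a j) (d a (j + 1)) h2
      (hΓ _ _ _ (hF1 _ _ h1) (hF1 _ _ h2) (h.2.1 (j + 1) hj j j.lt_succ_self))
    rw [← h.2.2 j hj] at this
    exact this.2
  have hone : ∀ a j, segSum labelWt a j (j + 1) = labelWt (a j) := fun a j => by simp [segSum]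
  have hcΓ : ∀ j S T, c * Γ j S T = ‖T‖ ^ q - ‖S‖ ^ q + 2 * e j := fun j S T =>
    mul_div_cancel₀ _ hc.ne'
  have hsumlow : ∀ a i j, i < j → alive a j →
      ‖d a j‖ ^ q - ‖d a i‖ ^ q + 2 * e i ≤ c * segSum labelWt a i j := by
    intro a i j hij
    induction j, hij using Nat.le_induction with
    | base =>
      intro h
      rw [hone, ← hcΓ]
      exact mul_le_mul_of_nonneg_left (hstep a _ h i i.lt_succ_self).1 hc.le
    | succ j hij ih =>
      intro h
      have h1 := ih (hmono _ _ _ j.le_succ h)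
      have h2 := mul_le_mul_of_nonneg_left (hstep a _ h j j.lt_succ_self).1 hc.le
      rw [hcΓ] at h2
      have hij' : i ≤ j := (Nat.lt_of_succ_le hij).le
      rw [← segSum_add a hij' j.le_succ, hone, mul_add]
      linarith [he j]
  have hsumup : ∀ a j, alive a j →
      c * segSum labelWt a 0 j ≤ ‖d a j‖ ^ q + (2 + c) * (2 - 2 * e j) := by
    intro a j
    induction j with
    | zero =>
      intro h
      have : e 0 = 1 := pow_zero _
      rw [segSum_of_le a le_rfl, this]
      have := Real.rpow_nonneg (norm_nonneg (d a 0)) q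
      linarith
    | succ j ih =>
      intro h
      have h1 := ih (hmono _ _ _ j.le_succ h)
      have h2 := mul_le_mul_of_nonneg_left (hstep a _ h j j.lt_succ_self).2 hc.le
      rw [mul_add, hcΓ] at h2
      rw [← segSum_add a j.zero_le j.le_succ, hone, mul_add]
      have := hes j
      nlinarith
  have hpow : ∀ a i j, i < j → alive a j →
      ‖d a j - d a i‖ ≤ segWt labelWt q (a, i, j) ∧ θ i ≤ e i * segWt labelWt q (a, i, j) := by
    intro a i j hij h
    have h1 := hsumlow a i j hij h
    have h2 := hVlow i (d a i) (d a j) (hF1 _ _ (h.1 i hij.le)) (hF1 _ _ (h.1 j le_rfl))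
      (h.2.1 j le_rfl i hij)
    have h3 := Real.rpow_nonneg (norm_nonneg (d a j - d a i)) q
    have hei := he i
    constructor
    · have h4 : ‖d a j - d a i‖ ^ q ≤ segSum labelWt a i j :=
        le_of_mul_le_mul_left (by linarith) hc
      have h5 := Real.rpow_le_rpow h3 h4 (show 0 ≤ 1 / q by positivity)
      rwa [← Real.rpow_mul (ContinuousLinearMap.opNorm_nonneg _), mul_one_div_cancel hq0.ne',
      Real.rpow_one] at h5
    · have h4 : e i / c ≤ segSum labelWt a i j := by
        rw [div_le_iff₀' hc]
        nlinarith
      exact mul_le_mul_of_nonneg_left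
        (Real.rpow_le_rpow (div_pos hei hc).le h4 (by positivity)) hei.le
  have hwt : ∀ a m n i j, m ≤ i → j ≤ n →
      segWt labelWt q (a, i, j) ≤ segWt labelWt q (a, m, n) := fun a m n i j h1 h2 =>
    Real.rpow_le_rpow (segSum_nonneg labelWt_pos _ _ _) (segSum_le_segSum labelWt_pos a h1 h2)
      (by positivity)
  have hDdiff : ∀ a m n, m ≤ n → D a n - D a m = 0 ∨
      ∃ j, m < j ∧ j ≤ n ∧ alive a j ∧ D a n - D a m = d a j - d a m := by
    intro a m n h
    rcases lastTrue_eq_or (h0 a) (hmono a) h with h1 | ⟨h1, h2⟩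
    · left
      simp only [D, h1, sub_self]
    · exact Or.inr ⟨_, h2, lastTrue_le n, lastTrue_spec (h0 a) (hmono a) n, by simp only [D, h1]⟩
  have hc' : 0 < (7 / c) ^ (-(1 / q)) := Real.rpow_pos_of_pos (by positivity) _
  refine isomToClosedSubspace_branchSpace labelWt_pos hq0 D ?_ ?_ (S := range x)
    (TopologicalSpace.denseRange_denseSeq X) hc' ?_ ?_
  · intro a b n h
    have : lastTrue (alive a) n = lastTrue (alive b) n := lastTrue_congr fun m hm =>
      ⟨halive a b m fun i hi => h i (hi.trans_le hm),
        halive b a m fun i hi => (h i (hi.trans_le hm)).symm⟩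
    simp only [D, this]
    exact hd a b _ fun i hi => h i (hi.trans_le (lastTrue_le n))
  · intro a m n hmn
    rcases hDdiff a m n hmn.le with h | ⟨j, h1, h2, h3, h4⟩
    · rw [h, norm_zero]
      exact segWt_nonneg labelWt_pos _
    · rw [h4]
      exact (hpow a m j h1 h3).1.trans (hwt a m n m j le_rfl h2)
  · rintro _ ⟨l, rfl⟩ r hr
    rcases le_or_gt r 0 with hr0 | hr0
    · refine ⟨0, 0, 1, one_pos, ?_⟩
      exact (mul_nonpos_of_nonpos_of_nonneg (mul_nonpos_of_nonneg_of_nonpos hc'.le hr0)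
        (segWt_nonneg labelWt_pos _)).trans (abs_nonneg _)
    obtain ⟨f, hf, hfx⟩ := exists_dual_vector'' ℝ (x l)
    obtain ⟨S, hS, hSV, hSf⟩ := hF f hf
    let a : ℕ → ℕ := fun j => lab j (S j) (S (j + 1))
    have hda : ∀ j, d a j = S j := by
      intro j
      cases j with
      | zero =>
        have := hS 0
        rw [hF0, Finset.mem_singleton] at this
        exact this.symm
      | succ j => exact (hlab j _ _ (hS _) (hΓ _ _ _ (hF1 _ _ (hS _)) (hF1 _ _ (hS _))
          (hSV _ _ j.lt_succ_self))).1
    have hal : ∀ m, alive a m := fun m => by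
      refine ⟨fun j _ => ?_, fun j _ i hi => ?_, fun j _ => ?_⟩
      · rw [hda]; exact hS j
      · rw [hda, hda]; exact hSV i j hi
      · exact congrArg₂ (lab j) (hda j).symm (hda (j + 1)).symm
    have hθlim : Tendsto θ atTop (𝓝 0) := by
      have h1 : Tendsto (fun n => (e n / c) ^ (1 / q)) atTop (𝓝 ((0 / c) ^ (1 / q))) :=
        (helim.div_const c).rpow_const (Or.inr (by positivity))
      have h2 := helim.mul h1
      rwa [zero_mul] at h2
    obtain ⟨n, hn, hnl⟩ := ((hθlim.eventually (ge_mem_nhds (sub_pos.2 hr))).and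
      (eventually_gt_atTop l)).exists
    refine ⟨a, 0, n, by omega, ?_⟩
    have hD : D a n - D a 0 = S n := by
      simp only [D, lastTrue_eq_self (hal _), hda]
      have := hda 0
      change 0 = S 0 at this
      rw [← this, sub_zero]
    rw [hD]
    have hw : segWt labelWt q (a, 0, n) ≤ (7 / c) ^ (1 / q) := by
      refine Real.rpow_le_rpow (segSum_nonneg labelWt_pos _ _ _) ?_ (by positivity)
      rw [le_div_iff₀' hc]
      have h1 := hsumup a n (hal n)
      have h2 : ‖d a n‖ ^ q ≤ 1 :=
        Real.rpow_le_one (norm_nonneg _) (hF1 _ _ ((hal n).1 n le_rfl)) hq0.le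
      nlinarith [he n]
    have h1 : (7 / c) ^ (-(1 / q)) * r * segWt labelWt q (a, 0, n) ≤ r := by
      calc (7 / c) ^ (-(1 / q)) * r * segWt labelWt q (a, 0, n)
          ≤ (7 / c) ^ (-(1 / q)) * r * (7 / c) ^ (1 / q) :=
            mul_le_mul_of_nonneg_left hw (by positivity)
        _ = r * ((7 / c) ^ (-(1 / q)) * (7 / c) ^ (1 / q)) := by ring
        _ = r := by rw [← Real.rpow_add (by positivity), neg_add_cancel, Real.rpow_zero, mul_one]
    have h2 := (hSf n).2 l hnl
    rw [sub_apply, hfx] at h2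
    have h3 := (abs_le.1 h2).2
    refine h1.trans (le_trans ?_ (le_abs_self _))
    have h4 : ((‖x l‖ : ℝ) : ℝ) - S n (x l) ≤ ‖x l‖ - r := h3.trans hn
    linarith
  · rintro _ ⟨l, rfl⟩ ε hε
    obtain ⟨n₀, hn₀, hln₀⟩ := ((helim.eventually (ge_mem_nhds hε)).and
      (eventually_gt_atTop l)).exists
    obtain ⟨k, hk, hkn⟩ : ∃ k, (∀ j ∈ Finset.range n₀, ∀ S ∈ F j, ∀ T ∈ F (j + 1), lab j S T < k) ∧
        n₀ ≤ k :=
      (((Finset.eventually_all _).2 fun j _ => (Finset.eventually_all _).2 fun S _ =>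
        (Finset.eventually_all _).2 fun T _ => eventually_gt_atTop (lab j S T)).and
          (eventually_ge_atTop n₀)).exists
    refine ⟨k, fun a m n hmn => ?_⟩
    set κ := stopLevel k a with hκ
    have hnn : 0 ≤ ε * segWt labelWt q (a, m, n) := mul_nonneg hε.le (segWt_nonneg labelWt_pos _)
    rcases le_or_gt n κ with hnκ | hκn
    · rw [min_eq_left hnκ, min_eq_left (hmn.le.trans hnκ), sub_self, abs_zero]
      exact hnn
    have e1 : (D a n - D a m) (x l) - (D a (min n κ) - D a (min m κ)) (x l)
        = (D a n - D a (max m κ)) (x l) := by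
      rw [min_eq_right hκn.le]
      rcases le_total m κ with h | h
      · rw [min_eq_left h, max_eq_right h]
        simp only [sub_apply]; ring
      · rw [min_eq_right h, max_eq_left h]
        simp
    rw [e1]
    rcases hDdiff a (max m κ) n (max_le hmn.le hκn.le) with h | ⟨j, h1, h2, h3, h4⟩
    · rw [h, zero_apply, abs_zero]
      exact hnn
    · have hκn₀ : n₀ ≤ κ := by
        by_contra! hlt
        have : ¬ κ + 1 ≤ stopLevel k a := by omega
        rw [le_stopLevel] at this
        push Not at this
        obtain ⟨i, hi, hki⟩ := this (by omega)
        have hij : i < j := by omega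
        have := hk i (Finset.mem_range.2 (by omega)) _ (h3.1 i hij.le) _ (h3.1 (i + 1) hij)
        rw [← h3.2.2 i hij] at this
        omega
      rw [h4]
      have hle := (h3.2.1 j le_rfl _ h1).2 l (by omega)
      refine (hle.trans (hpow a _ j h1 h3).2).trans ?_
      exact mul_le_mul ((hanti (show n₀ ≤ max m κ by omega)).trans hn₀)
        (hwt a m n _ j (le_max_left _ _) h2) (segWt_nonneg labelWt_pos _) hε.le

end

section Chains

/-- Lists of segments that lie level-wise one below the other, the last one first. -/
def IsChain (l : List Seg) : Prop :=
  l.Pairwise (fun s t => t.2.2 ≤ s.2.1) ∧ ∀ s ∈ l, s.2.1 ≤ s.2.2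

/-- The sum of the `q`-th powers of the increments of `F` along a list of segments. -/
noncomputable def chainSum (q : ℝ) (F : (ℕ → ℕ) → ℕ → ℝ) (l : List Seg) : ℝ :=
  (l.map fun s => |F s.1 s.2.2 - F s.1 s.2.1| ^ q).sum

variable {q : ℝ}

lemma chainSum_append (F : (ℕ → ℕ) → ℕ → ℝ) (l l' : List Seg) :
    chainSum q F (l ++ l') = chainSum q F l + chainSum q F l' := by
  simp [chainSum]

lemma chainSum_smul {t : ℝ} (ht : 0 ≤ t) (F : (ℕ → ℕ) → ℕ → ℝ) (l : List Seg) :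
    chainSum q (t • F) l = t ^ q * chainSum q F l := by
  rw [chainSum, chainSum, ← List.sum_map_mul_left]
  refine congrArg List.sum (List.map_congr_left fun s _ => ?_)
  simp only [Pi.smul_apply, smul_eq_mul]
  rw [← mul_sub, abs_mul, abs_of_nonneg ht, Real.mul_rpow ht (abs_nonneg _)]

/-- The part of a segment up to level `k`. -/
def Seg.below (k : ℕ) (s : Seg) : Seg := (s.1, min s.2.1 k, min s.2.2 k)

/-- The part of a segment from level `k` on. -/
def Seg.above (k : ℕ) (s : Seg) : Seg := (s.1, max s.2.1 k, max s.2.2 k)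

lemma IsChain.below {l : List Seg} (h : IsChain l) (k : ℕ) : IsChain (l.map (Seg.below k)) := by
  refine ⟨List.pairwise_map.2 (h.1.imp fun hst => min_le_min_right k hst), fun s hs => ?_⟩
  obtain ⟨t, ht, rfl⟩ := List.mem_map.1 hs
  exact min_le_min_right k (h.2 t ht)

lemma IsChain.above_append_below {l l' : List Seg} (h : IsChain l) (h' : IsChain l') (k : ℕ) :
    IsChain (l.map (Seg.above k) ++ l'.map (Seg.below k)) := by
  refine ⟨List.pairwise_append.2 ⟨List.pairwise_map.2 (h.1.imp fun hst => max_le_max_right k hst),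
    (h'.below k).1, fun s hs t ht => ?_⟩, fun s hs => ?_⟩
  · obtain ⟨s, -, rfl⟩ := List.mem_map.1 hs
    obtain ⟨t, -, rfl⟩ := List.mem_map.1 ht
    exact (min_le_right _ _).trans (le_max_right _ _)
  · rcases List.mem_append.1 hs with hs | hs
    · obtain ⟨t, ht, rfl⟩ := List.mem_map.1 hs
      exact max_le_max_right k (h.2 t ht)
    · exact (h'.below k).2 s hs

variable (q)

/-- Adapted functions on the tree with `q`-variation at most one along chains. -/
def ChainBall : Set ((ℕ → ℕ) → ℕ → ℝ) :=
  {F | (∀ a, F a 0 = 0) ∧ (∀ a b n, (∀ i < n, a i = b i) → F a n = F b n) ∧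
    ∀ l, IsChain l → chainSum q F l ≤ 1}

variable {q}

lemma ChainBall.abs_le_one (hq : 0 < q) {F : (ℕ → ℕ) → ℕ → ℝ} (hF : F ∈ ChainBall q) (a : ℕ → ℕ)
    (n : ℕ) : |F a n| ≤ 1 := by
  have := hF.2.2 [(a, 0, n)] ⟨List.pairwise_singleton _ _, by simp⟩
  simp only [chainSum, List.map_cons, List.map_nil, List.sum_cons, List.sum_nil, add_zero, hF.1,
    sub_zero] at this
  by_contra! h
  exact absurd this (not_le.2 (Real.one_lt_rpow h hq))

/-- Freezing a function on the tree after level `k`. -/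
def truncate (k : ℕ) (F : (ℕ → ℕ) → ℕ → ℝ) : (ℕ → ℕ) → ℕ → ℝ := fun a n => F a (min n k)

lemma chainSum_truncate (k : ℕ) (F : (ℕ → ℕ) → ℕ → ℝ) (l : List Seg) :
    chainSum q (truncate k F) l = chainSum q F (l.map (Seg.below k)) := by
  simp only [chainSum, List.map_map]
  rfl

lemma chainSum_sub_truncate (k : ℕ) (F : (ℕ → ℕ) → ℕ → ℝ) (l : List Seg) :
    chainSum q (F - truncate k F) l = chainSum q F (l.map (Seg.above k)) := by
  have h : ∀ a n, (F - truncate k F) a n = F a (max n k) - F a k := by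
    intro a n
    simp only [Pi.sub_apply, truncate]
    rcases le_total n k with h | h
    · rw [min_eq_left h, max_eq_right h, sub_self, sub_self]
    · rw [min_eq_right h, max_eq_left h]
  simp only [chainSum, List.map_map, h, sub_sub_sub_cancel_right]
  rfl

lemma truncate_mem {F : (ℕ → ℕ) → ℕ → ℝ} (hF : F ∈ ChainBall q) (k : ℕ) :
    truncate k F ∈ ChainBall q := by
  refine ⟨fun a => ?_, fun a b n h => ?_, fun l hl => ?_⟩
  · simp [truncate, hF.1]
  · exact hF.2.1 a b _ fun i hi => h i (hi.trans_le (min_le_left _ _))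
  · rw [chainSum_truncate]
    exact hF.2.2 _ (hl.below k)

/-- Evaluation at a node of the tree. -/
noncomputable def nodeEval (hq : 0 < q) (a : ℕ → ℕ) (n : ℕ) : Linf (ChainBall q) :=
  Linf.mk (fun F => F.1 a n) 1 fun F => ChainBall.abs_le_one hq F.2 a n

lemma norm_nodeEval_le (hq : 0 < q) (a : ℕ → ℕ) (n : ℕ) : ‖nodeEval hq a n‖ ≤ 1 :=
  Linf.norm_le zero_le_one fun F => ChainBall.abs_le_one hq F.2 a n

/-- The span of the evaluations at finitely many nodes of the tree. -/
noncomputable def nodeLevel (hq : 0 < q) (k : ℕ) : Submodule ℝ (Linf (ChainBall q)) :=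
  Submodule.span ℝ {φ | ∃ a n, (∀ i, a i ≤ i) ∧ n ≤ k ∧ φ = nodeEval hq a n}

lemma nodeEval_mem (hq : 0 < q) {a : ℕ → ℕ} (ha : ∀ i, a i ≤ i) {n k : ℕ} (h : n ≤ k) :
    nodeEval hq a n ∈ nodeLevel hq k := Submodule.subset_span ⟨a, n, ha, h, rfl⟩

lemma nodeLevel_mono (hq : 0 < q) : Monotone (nodeLevel hq) := fun _ _ h =>
  Submodule.span_mono fun _ ⟨a, n, h1, h2, h3⟩ => ⟨a, n, h1, h2.trans h, h3⟩

lemma finiteDimensional_nodeLevel (hq : 0 < q) (k : ℕ) :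
    FiniteDimensional ℝ (nodeLevel hq k) := by
  refine FiniteDimensional.span_of_finite ℝ ?_
  refine (Set.finite_range fun t : (Fin k → Fin k) × Fin (k + 1) =>
    nodeEval hq (fun i => if h : i < k then (t.1 ⟨i, h⟩ : ℕ) else 0) t.2).subset ?_
  rintro _ ⟨a, n, ha, hn, rfl⟩
  refine ⟨(fun i => ⟨a i, (ha i).trans_lt i.2⟩, ⟨n, Nat.lt_succ_of_le hn⟩), ?_⟩
  refine lp.ext (funext fun F => ?_)
  exact F.2.2.1 _ _ n fun i hi => dif_pos (hi.trans_le hn)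

/-- The projection induced by truncation. -/
noncomputable def nodeProj (k : ℕ) : Linf (ChainBall q) →L[ℝ] Linf (ChainBall q) :=
  Linf.wcomp (fun _ => 1) (fun _ => by simp) fun F => ⟨truncate k F.1, truncate_mem F.2 k⟩

lemma nodeProj_apply (k : ℕ) (φ : Linf (ChainBall q)) (F : ChainBall q) :
    nodeProj k φ F = φ ⟨truncate k F.1, truncate_mem F.2 k⟩ := by
  rw [nodeProj, Linf.wcomp_apply, one_mul]

lemma nodeProj_nodeEval (hq : 0 < q) (k : ℕ) (a : ℕ → ℕ) (n : ℕ) :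
    nodeProj k (nodeEval hq a n) = nodeEval hq a (min n k) :=
  lp.ext (funext fun F => by rw [nodeProj_apply]; rfl)

lemma nodeProj_mem (hq : 0 < q) (k j : ℕ) {u : Linf (ChainBall q)} (hu : u ∈ nodeLevel hq j) :
    nodeProj k u ∈ nodeLevel hq k := by
  refine Submodule.span_induction (p := fun u _ => nodeProj k u ∈ nodeLevel hq k) ?_ ?_ ?_ ?_ hu
  · rintro _ ⟨a, n, ha, -, rfl⟩
    rw [nodeProj_nodeEval]
    exact nodeEval_mem hq ha (min_le_right _ _)
  · rw [map_zero]; exact Submodule.zero_mem _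
  · intro x y _ _ hx hy
    rw [map_add]; exact Submodule.add_mem _ hx hy
  · intro c x _ hx
    rw [map_smul]; exact Submodule.smul_mem _ c hx

lemma nodeProj_eq (hq : 0 < q) (k : ℕ) {u : Linf (ChainBall q)} (hu : u ∈ nodeLevel hq k) :
    nodeProj k u = u := by
  refine Submodule.span_induction (p := fun u _ => nodeProj k u = u) ?_ ?_ ?_ ?_ hu
  · rintro _ ⟨a, n, -, hn, rfl⟩
    rw [nodeProj_nodeEval, min_eq_left hn]
  · rw [map_zero]
  · intro x y _ _ hx hy
    rw [map_add, hx, hy]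
  · intro c x _ hx
    rw [map_smul, hx]

/-- Evaluation at a node of the tree as a linear functional. -/
def evalAt (a : ℕ → ℕ) (n : ℕ) : ((ℕ → ℕ) → ℕ → ℝ) →ₗ[ℝ] ℝ where
  toFun F := F a n
  map_add' _ _ := rfl
  map_smul' _ _ := rfl

lemma exists_linear_of_mem_nodeLevel (hq : 0 < q) (k : ℕ) {u : Linf (ChainBall q)}
    (hu : u ∈ nodeLevel hq k) :
    ∃ L : ((ℕ → ℕ) → ℕ → ℝ) →ₗ[ℝ] ℝ, ∀ F : ChainBall q, u F = L F.1 := by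
  refine Submodule.span_induction
    (p := fun u _ => ∃ L : ((ℕ → ℕ) → ℕ → ℝ) →ₗ[ℝ] ℝ, ∀ F : ChainBall q, u F = L F.1)
    ?_ ?_ ?_ ?_ hu
  · rintro _ ⟨a, n, -, -, rfl⟩
    exact ⟨evalAt a n, fun F => rfl⟩
  · exact ⟨0, fun F => rfl⟩
  · rintro x y _ _ ⟨L, hL⟩ ⟨M, hM⟩
    exact ⟨L + M, fun F => by simp [hL, hM]⟩
  · rintro c x _ ⟨L, hL⟩
    exact ⟨c • L, fun F => by simp [hL]⟩

lemma abs_linear_le (hq : 0 < q) {u : Linf (ChainBall q)} {L : ((ℕ → ℕ) → ℕ → ℝ) →ₗ[ℝ] ℝ}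
    (hL : ∀ F : ChainBall q, u F = L F.1) {G : (ℕ → ℕ) → ℕ → ℝ} (h0 : ∀ a, G a 0 = 0)
    (hG : ∀ a b n, (∀ i < n, a i = b i) → G a n = G b n) {A : ℝ}
    (hA : ∀ l, IsChain l → chainSum q G l ≤ A) : |L G| ≤ A ^ (1 / q) * ‖u‖ := by
  have hA0 : 0 ≤ A := hA [] ⟨List.Pairwise.nil, by simp⟩
  rcases hA0.eq_or_lt with rfl | hA0
  · have : G = 0 := by
      funext a n
      have := hA [(a, 0, n)] ⟨List.pairwise_singleton _ _, by simp⟩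
      simp only [chainSum, List.map_cons, List.map_nil, List.sum_cons, List.sum_nil, add_zero, h0,
        sub_zero] at this
      by_contra h
      exact absurd this (not_le.2 (Real.rpow_pos_of_pos (abs_pos.2 h) q))
    rw [this, map_zero, abs_zero]
    positivity
  · set α := A ^ (1 / q) with hα
    have hα0 : 0 < α := Real.rpow_pos_of_pos hA0 _
    have hαq : α ^ q = A := by
      rw [hα, ← Real.rpow_mul hA0.le, one_div_mul_cancel hq.ne', Real.rpow_one]
    have hmem : α⁻¹ • G ∈ ChainBall q := by
      refine ⟨fun a => by simp [h0], fun a b n h => ?_, fun l hl => ?_⟩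
      · simp only [Pi.smul_apply, hG a b n h]
      · rw [chainSum_smul (by positivity), Real.inv_rpow hα0.le, hαq, inv_mul_le_iff₀ hA0, mul_one]
        exact hA l hl
    have h1 := Linf.abs_le_norm u ⟨_, hmem⟩
    rw [hL, map_smul, smul_eq_mul, abs_mul, abs_inv, abs_of_pos hα0, inv_mul_le_iff₀ hα0] at h1
    exact h1

lemma node_estimate {p : ℝ} (hpq : p.HolderConjugate q) (hq : 0 < q) (k j : ℕ)
    {u v : Linf (ChainBall q)} (hu : u ∈ nodeLevel hq k) (hv : v ∈ nodeLevel hq j) :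
    ‖u + (v - nodeProj k v)‖ ^ p ≤ ‖u‖ ^ p + ‖v - nodeProj k v‖ ^ p := by
  set w := v - nodeProj k v with hw
  have hwm : w ∈ nodeLevel hq (max j k) := Submodule.sub_mem _
    (nodeLevel_mono hq (le_max_left _ _) hv)
    (nodeLevel_mono hq (le_max_right _ _) (nodeProj_mem hq k j hv))
  have hwk : nodeProj k w = 0 := by
    rw [hw, map_sub, nodeProj_eq hq k (nodeProj_mem hq k j hv), sub_self]
  obtain ⟨L, hL⟩ := exists_linear_of_mem_nodeLevel hq k hu
  obtain ⟨M, hM⟩ := exists_linear_of_mem_nodeLevel hq _ hwm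
  refine Linf.norm_add_rpow_le hpq fun F => ?_
  have hF := F.2
  set T := truncate k F.1 with hT
  have hTm : T ∈ ChainBall q := truncate_mem hF k
  have hsum : ∀ l l', IsChain l → IsChain l' →
      chainSum q (F.1 - T) l + chainSum q T l' ≤ 1 := fun l l' hl hl' => by
    rw [chainSum_sub_truncate, chainSum_truncate, ← chainSum_append]
    exact hF.2.2 _ (hl.above_append_below hl' k)
  have hnil : IsChain [] := ⟨List.Pairwise.nil, by simp⟩
  have : Nonempty {l // IsChain l} := ⟨⟨[], hnil⟩⟩
  have hbdd : BddAbove (range fun l : {l // IsChain l} => chainSum q T l) :=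
    ⟨1, by rintro _ ⟨l, rfl⟩; exact hTm.2.2 _ l.2⟩
  set A := ⨆ l : {l // IsChain l}, chainSum q T l with hA
  have hTA : ∀ l, IsChain l → chainSum q T l ≤ A := fun l hl => le_ciSup hbdd ⟨l, hl⟩
  have hGA : ∀ l, IsChain l → chainSum q (F.1 - T) l ≤ 1 - A := fun l hl => by
    have : A ≤ 1 - chainSum q (F.1 - T) l := ciSup_le fun l' => by linarith [hsum l l' hl l'.2]
    linarith
  have hA0 : 0 ≤ A := hTA [] hnil
  have hA1 : 0 ≤ 1 - A := hGA [] hnil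
  have e : ∀ B : ℝ, 0 ≤ B → (B ^ (1 / q)) ^ q = B := fun B hB => by
    rw [← Real.rpow_mul hB, one_div_mul_cancel hq.ne', Real.rpow_one]
  refine ⟨A ^ (1 / q), by positivity, (1 - A) ^ (1 / q), by positivity, ?_, ?_, ?_⟩
  · rw [e A hA0, e _ hA1]; linarith
  · have h1 : u F = L T := by
      rw [← nodeProj_eq hq k hu, nodeProj_apply, hL]
    rw [h1]
    exact abs_linear_le hq hL hTm.1 hTm.2.1 hTA
  · have h1 : w F = M (F.1 - T) := by
      have h2 : w ⟨T, hTm⟩ = 0 := by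
        rw [← nodeProj_apply, hwk]; rfl
      rw [map_sub, ← hM F, ← hM ⟨T, hTm⟩, h2, sub_zero]
    rw [h1]
    refine abs_linear_le hq hM (fun a => ?_) (fun a b n h => ?_) hGA
    · rw [Pi.sub_apply, Pi.sub_apply, hF.1, hTm.1, sub_zero]
    · rw [Pi.sub_apply, Pi.sub_apply, Pi.sub_apply, Pi.sub_apply, hF.2.1 a b n h, hTm.2.1 a b n h]

/-- The space having all `p`-AUS-able separable spaces as quotients. -/
noncomputable abbrev ChainSpace (hq : 0 < q) : Submodule ℝ (Linf (ChainBall q)) :=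
  (⨆ k, nodeLevel hq k).topologicalClosure

lemma separableSpace_chainSpace (hq : 0 < q) :
    TopologicalSpace.SeparableSpace (ChainSpace hq) := by
  have := finiteDimensional_nodeLevel hq
  exact separableSpace_closure _ (nodeLevel_mono hq)

lemma weakUpper_chainSpace {p : ℝ} (hpq : p.HolderConjugate q) (hq : 0 < q) :
    WeakUpper p (ChainSpace hq) := by
  have := finiteDimensional_nodeLevel hq
  exact weakUpper_closure _ hpq.lt (nodeLevel_mono hq) nodeProj
    (fun k v => Linf.norm_wcomp_le _ _ _ v)
    (fun k j u hu => nodeProj_mem hq k j hu)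
    (fun k j u hu v hv => node_estimate hpq hq k j hu hv)

end Chains

section

variable {X Y : Type*} [NormedAddCommGroup X] [NormedSpace ℝ X] [NormedAddCommGroup Y]
  [NormedSpace ℝ Y]

lemma surjective_of_approx [CompleteSpace Y] (Q : Y →L[ℝ] X)
    (h : ∀ x : X, ‖x‖ ≤ 1 → ∃ u : Y, ‖u‖ ≤ 1 ∧ ‖x - Q u‖ ≤ 1 / 2) : Function.Surjective Q := by
  have hx : ∀ x : X, ∃ u : Y, ‖u‖ ≤ ‖x‖ ∧ ‖x - Q u‖ ≤ 1 / 2 * ‖x‖ := by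
    intro x
    rcases eq_or_ne x 0 with rfl | hx
    · exact ⟨0, by simp, by simp⟩
    · have hx0 : 0 < ‖x‖ := norm_pos_iff.2 hx
      obtain ⟨u, h1, h2⟩ := h (‖x‖⁻¹ • x) (by
      rw [norm_smul, norm_inv, norm_norm, inv_mul_cancel₀ hx0.ne'])
      refine ⟨‖x‖ • u, ?_, ?_⟩
      · rw [norm_smul, norm_norm]
        nlinarith
      · have : x - Q (‖x‖ • u) = ‖x‖ • (‖x‖⁻¹ • x - Q u) := by
          rw [smul_sub, smul_inv_smul₀ hx0.ne', map_smul]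
        rw [this, norm_smul, norm_norm]
        nlinarith
  choose g hg1 hg2 using hx
  intro x
  let r : ℕ → X := fun n => Nat.rec x (fun _ y => y - Q (g y)) n
  have hr : ∀ n, r (n + 1) = r n - Q (g (r n)) := fun n => rfl
  have hrn : ∀ n, ‖r n‖ ≤ (1 / 2) ^ n * ‖x‖ := by
    intro n
    induction n with
    | zero => simp [r]
    | succ n ih =>
      rw [hr, pow_succ]
      linarith [hg2 (r n)]
  have hgeo : Summable fun n : ℕ => (1 / 2 : ℝ) ^ n * ‖x‖ :=
    (summable_geometric_of_lt_one (by norm_num) (by norm_num)).mul_right _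
  have hsum : Summable fun n => g (r n) :=
    Summable.of_norm_bounded hgeo fun n => (hg1 _).trans (hrn n)
  refine ⟨∑' n, g (r n), ?_⟩
  have h1 : Tendsto (fun n => Q (∑ i ∈ Finset.range n, g (r i))) atTop (𝓝 (Q (∑' n, g (r n)))) :=
    (Q.continuous.tendsto _).comp hsum.hasSum.tendsto_sum_nat
  have h2 : ∀ n, Q (∑ i ∈ Finset.range n, g (r i)) = x - r n := by
    intro n
    induction n with
    | zero => simp [r]
    | succ n ih => rw [Finset.sum_range_succ, map_add, ih, hr]; abel
  have h3 : Tendsto r atTop (𝓝 0) := squeeze_zero_norm hrn hgeo.tendsto_atTop_zero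
  have h4 : Tendsto (fun n => x - r n) atTop (𝓝 (x - 0)) := h3.const_sub x
  rw [sub_zero] at h4
  exact tendsto_nhds_unique (h1.congr h2) h4

lemma isQuotientOf_chainSpace [CompleteSpace X] {q : ℝ} (hq : 0 < q) (S : (ℕ → ℕ) → ℕ → X)
    (h0 : ∀ a, S a 0 = 0) (hS : ∀ a b n, (∀ i < n, a i = b i) → S a n = S b n) {M : ℝ}
    (hM : ∀ f : StrongDual ℝ X, ‖f‖ ≤ 1 → ∀ l, IsChain l → chainSum q (fun a n => f (S a n)) l ≤ M)
    (hdense : ∀ x : X, ‖x‖ ≤ 1 → ∃ a n, (∀ i, a i ≤ i) ∧ ‖x - S a n‖ ≤ 1 / 2) :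
    IsQuotientOf X (ChainSpace hq) := by
  let ι := {a : ℕ → ℕ // ∀ i, a i ≤ i} × ℕ
  have hmem : ∀ i : ι, nodeEval hq i.1.1 i.2 ∈ ⨆ k, nodeLevel hq k := fun i =>
    Submodule.mem_iSup_of_mem i.2 (nodeEval_mem hq i.1.2 le_rfl)
  let b : ι → ChainSpace hq := fun i =>
    ⟨nodeEval hq i.1.1 i.2, Submodule.le_topologicalClosure _ (hmem i)⟩
  let e : (ι →₀ ℝ) →ₗ[ℝ] ChainSpace hq := Finsupp.linearCombination ℝ b
  let s : (ι →₀ ℝ) →ₗ[ℝ] X := Finsupp.linearCombination ℝ fun i : ι => S i.1.1 i.2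
  have hdr : DenseRange e := by
    intro x
    refine Metric.mem_closure_iff.2 fun ε hε => ?_
    obtain ⟨y, hy, hxy⟩ := Metric.mem_closure_iff.1 x.2 ε hε
    have hle : (⨆ k, nodeLevel hq k) ≤
        (LinearMap.range e).map (ChainSpace hq).subtype := by
      refine iSup_le fun k => Submodule.span_le.2 ?_
      rintro _ ⟨a, n, ha, -, rfl⟩
      exact ⟨b (⟨a, ha⟩, n), ⟨Finsupp.single (⟨a, ha⟩, n) 1, by simp [e]⟩, rfl⟩
    obtain ⟨_, ⟨z, rfl⟩, hz⟩ := hle hy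
    exact ⟨e z, ⟨z, rfl⟩, by rw [← hz] at hxy; exact hxy⟩
  have hbound : ∀ z, ‖s z‖ ≤ M ^ (1 / q) * ‖e z‖ := by
    intro z
    obtain ⟨f, hf, hfz⟩ := exists_dual_vector'' ℝ (s z)
    let L : ((ℕ → ℕ) → ℕ → ℝ) →ₗ[ℝ] ℝ :=
      ∑ i ∈ z.support, z i • evalAt i.1.1 i.2
    have hLF : ∀ F, L F = ∑ i ∈ z.support, z i * F i.1.1 i.2 := fun F => by
      simp [L, LinearMap.sum_apply, evalAt]
    have hL : ∀ F : ChainBall q, (e z).1 F = L F.1 := by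
      intro F
      rw [hLF]
      have : ((e z).1 : Linf (ChainBall q)) = ∑ i ∈ z.support, z i • nodeEval hq i.1.1 i.2 := by
        simp [e, b, Finsupp.linearCombination_apply, Finsupp.sum]
      rw [this, lp.coeFn_sum, Finset.sum_apply]
      rfl
    have h1 := abs_linear_le hq hL (G := fun a n => f (S a n)) (fun a => by rw [h0, map_zero])
      (fun a b n h => by rw [hS a b n h]) (hM f hf)
    have h2 : L (fun a n => f (S a n)) = f (s z) := by
      rw [hLF]
      simp [s, Finsupp.linearCombination_apply, Finsupp.sum]
    rw [h2, hfz] at h1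
    exact (le_abs_self _).trans h1
  refine ⟨s.extendOfNorm e, surjective_of_approx _ fun x hx => ?_⟩
  obtain ⟨a, n, ha, h⟩ := hdense x hx
  refine ⟨b (⟨a, ha⟩, n), norm_nodeEval_le hq a n, ?_⟩
  have h1 : e (Finsupp.single (⟨a, ha⟩, n) 1) = b (⟨a, ha⟩, n) := by simp [e]
  have h2 : s (Finsupp.single (⟨a, ha⟩, n) 1) = S a n := by simp [s]
  rw [← h1, LinearMap.extendOfNorm_eq hdr ⟨_, hbound⟩, h2]
  exact h

end

section

variable {X : Type*} [NormedAddCommGroup X] [NormedSpace ℝ X] {q : ℝ}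

lemma exists_antitone_le (δ : ℕ → ℝ) (hδ : ∀ n, 0 < δ n) :
    ∃ η : ℕ → ℝ, Antitone η ∧ ∀ n, 0 < η n ∧ η n ≤ δ n := by
  let η : ℕ → ℝ := fun n => Nat.rec (δ 0) (fun n r => min r (δ (n + 1))) n
  have h : ∀ n, η (n + 1) = min (η n) (δ (n + 1)) := fun n => rfl
  refine ⟨η, antitone_nat_of_succ_le fun n => by rw [h]; exact min_le_left _ _, fun n => ?_⟩
  induction n with
  | zero => exact ⟨hδ 0, le_rfl⟩
  | succ n ih => rw [h]; exact ⟨lt_min ih.1 (hδ _), min_le_right _ _⟩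

section Decoding

lemma exists_levels {X : Type*} [AddCommGroup X] (G : ℕ → Finset X) (hG0 : G 0 = {0}) :
    ∃ (N : ℕ → ℕ) (dec : ℕ → ℕ → X), Monotone N ∧ N 0 = 0 ∧ (∀ j, ∃ n, j ≤ N n) ∧
      ∀ n, ∀ y ∈ G (N (n + 1)), ∃ k ≤ n, dec n k = y := by
  classical
  let N : ℕ → ℕ := fun n => Nat.findGreatest (fun j => (G j).card ≤ n) n
  refine ⟨N, fun n k => (G (N (n + 1))).toList.getD k 0, fun m n h => ?_, rfl, fun j => ?_,
    fun n y hy => ?_⟩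
  · exact Nat.findGreatest_mono (fun j hj => hj.trans h) h
  · exact ⟨max j (G j).card, Nat.le_findGreatest (le_max_left _ _) (le_max_right _ _)⟩
  · have hcard : (G (N (n + 1))).card ≤ n + 1 :=
      Nat.findGreatest_spec (P := fun j => (G j).card ≤ n + 1) (Nat.zero_le _) (by simp [hG0])
    obtain ⟨k, hk, hky⟩ := List.mem_iff_getElem.1 (Finset.mem_toList.2 hy)
    rw [Finset.length_toList] at hk
    exact ⟨k, by omega, by simp [hky, hk]⟩

end Decoding

lemma exists_nets {c : ℝ} (hX : ∀ (f : StrongDual ℝ X) (R ε : ℝ), 0 < ε →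
      ∀ᶠ g in weakStarZero X, ‖g‖ ≤ R → ‖f‖ ^ q + c * ‖g‖ ^ q ≤ ‖f + g‖ ^ q + ε)
    (ε η : ℕ → ℝ) (hε : ∀ n, 0 < ε n) (hη : ∀ n, 0 < η n) (x : ℕ → X) (hx : ∀ n, ‖x n‖ ≤ 1) :
    ∃ (G : ℕ → Finset X) (Ψ : ℕ → Finset (StrongDual ℝ X)), G 0 = {0} ∧ Ψ 0 = ∅ ∧ Monotone G ∧
      Monotone Ψ ∧ (∀ j, ∀ v ∈ G j, ‖v‖ ≤ 1) ∧
      (∀ j (f : StrongDual ℝ X), ‖f‖ ≤ 1 → ∃ S ∈ Ψ (j + 1), ‖S‖ ≤ 1 ∧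
        ‖S‖ ^ q + c * ‖f - S‖ ^ q ≤ ‖f‖ ^ q + ε j ∧ ∀ v ∈ G j, |(f - S) v| ≤ η j) ∧
      (∀ j (y : X), ‖y‖ ≤ 1 → ∃ v ∈ G (j + 1), ∀ φ ∈ Ψ (j + 1), |φ (y - v)| ≤ η j) ∧
      ∀ j, x j ∈ G (j + 1) := by
  classical
  have step : ∀ (j : ℕ) (G : Finset X) (Ψ : Finset (StrongDual ℝ X)),
      ∃ (G' : Finset X) (Ψ' : Finset (StrongDual ℝ X)), G ⊆ G' ∧ Ψ ⊆ Ψ' ∧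
        ((∀ v ∈ G, ‖v‖ ≤ 1) → ∀ v ∈ G', ‖v‖ ≤ 1) ∧
        (∀ (f : StrongDual ℝ X), ‖f‖ ≤ 1 → ∃ S ∈ Ψ', ‖S‖ ≤ 1 ∧
          ‖S‖ ^ q + c * ‖f - S‖ ^ q ≤ ‖f‖ ^ q + ε j ∧ ∀ v ∈ G, |(f - S) v| ≤ η j) ∧
        (∀ (y : X), ‖y‖ ≤ 1 → ∃ v ∈ G', ∀ φ ∈ Ψ', |φ (y - v)| ≤ η j) ∧ x j ∈ G' := by
    intro j G Ψ
    obtain ⟨F, hF1, hF⟩ := exists_finite_cover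
      (fun S : StrongDual ℝ X => {g | (‖g‖ ≤ 2 → ‖S‖ ^ q + c * ‖g‖ ^ q ≤ ‖S + g‖ ^ q + ε j) ∧
        ∀ v ∈ G, |g v| < η j}) fun S => (hX S 2 (ε j) (hε j)).and
          ((Finset.eventually_all G).2 fun v _ => weakStarZero_abs_lt v (hη j))
    obtain ⟨H, hH1, hH⟩ := exists_finite_net (Ψ ∪ F) (hη j)
    refine ⟨insert (x j) (G ∪ H), Ψ ∪ F, ?_, Finset.subset_union_left, ?_, fun f hf => ?_,
      fun y hy => ?_, Finset.mem_insert_self _ _⟩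
    · exact Finset.subset_union_left.trans (Finset.subset_insert _ _)
    · intro hG v hv
      rcases Finset.mem_insert.1 hv with rfl | hv
      · exact hx j
      · exact (Finset.mem_union.1 hv).elim (hG v) (hH1 v)
    · obtain ⟨S, hS, h1, h2⟩ := hF f hf
      refine ⟨S, Finset.mem_union_right _ hS, hF1 S hS, ?_, fun v hv => (h2 v hv).le⟩
      have := h1 ((norm_sub_le _ _).trans (by linarith [hF1 S hS]))
      rwa [add_sub_cancel] at this
    · obtain ⟨s, hs, h⟩ := hH y hy
      exact ⟨s, Finset.mem_insert_of_mem (Finset.mem_union_right _ hs), fun φ hφ => (h φ hφ).le⟩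
  choose G' Ψ' h1 h2 h3 h4 h5 h6 using step
  let P : ℕ → Finset X × Finset (StrongDual ℝ X) := fun n =>
    Nat.rec ({0}, ∅) (fun n P => (G' n P.1 P.2, Ψ' n P.1 P.2)) n
  refine ⟨fun n => (P n).1, fun n => (P n).2, rfl, rfl, monotone_nat_of_le_succ fun n => h1 n _ _,
    monotone_nat_of_le_succ fun n => h2 n _ _, fun j => ?_, fun j => h4 j _ _, fun j => h5 j _ _,
    fun j => h6 j _ _⟩
  induction j with
  | zero =>
    intro v hv
    rw [Finset.mem_singleton.1 (show v ∈ ({0} : Finset X) from hv), norm_zero]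
    exact zero_le_one
  | succ j ih => exact h3 j _ _ ih

lemma length_le_of_pairwise {α : Type*} (L : List (ℕ × ℕ × α)) (m : ℕ)
    (hL : L.Pairwise fun s t => t.2.1 ≤ s.1) (h : ∀ s ∈ L, s.1 < s.2.1) (hm : ∀ s ∈ L, s.2.1 ≤ m) :
    L.length ≤ m := by
  induction L generalizing m with
  | nil => exact Nat.zero_le m
  | cons s L ih =>
    rw [List.pairwise_cons] at hL
    have h1 := ih s.1 hL.2 (fun t ht => h t (List.mem_cons_of_mem _ ht)) hL.1
    have h2 := h s List.mem_cons_self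
    have h3 := hm s List.mem_cons_self
    rw [List.length_cons]
    omega

/-- Increments between a point of the `l`-th net and a point of the `e`-th net that are almost
annihilated by the `l`-th dual net. -/
def Increment (G : ℕ → Finset X) (Ψ : ℕ → Finset (StrongDual ℝ X)) (η : ℕ → ℝ) (l e : ℕ) (v : X) :
    Prop :=
  l < e ∧ (∃ y ∈ G l, ∃ z ∈ G e, v = z - y) ∧ ∀ φ ∈ Ψ l, |φ v| ≤ 2 * η (l - 1)

lemma sum_increments_le (hq : 0 < q) {G : ℕ → Finset X} {Ψ : ℕ → Finset (StrongDual ℝ X)}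
    {ε η κ : ℕ → ℝ} {c C : ℝ} (hGm : Monotone G) (hG1 : ∀ j, ∀ v ∈ G j, ‖v‖ ≤ 1)
    (hΨ : ∀ j (f : StrongDual ℝ X), ‖f‖ ≤ 1 → ∃ S ∈ Ψ (j + 1), ‖S‖ ≤ 1 ∧
      ‖S‖ ^ q + c * ‖f - S‖ ^ q ≤ ‖f‖ ^ q + ε j ∧ ∀ v ∈ G j, |(f - S) v| ≤ η j)
    (hη : ∀ j, 0 < η j ∧ η j ≤ 1) (hκ : ∀ j s t, 0 ≤ s → s ≤ 2 → 0 ≤ t → t ≤ 2 → s ≤ t + 2 * η j →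
      s ^ q ≤ t ^ q + κ j)
    (hsum : ∀ j, C * ε j + κ j * (j + 1) + 4 ^ q * κ j ≤ (1 / 2) ^ j)
    (hκ0 : ∀ j, 0 ≤ κ j) (hC0 : 0 ≤ C) (hC : 2 * 8 ^ q ≤ C * c) (hC4 : 4 ^ q ≤ C)
    (L : List (ℕ × ℕ × X)) (s₀ : ℕ × ℕ × X)
    (hL : (s₀ :: L).Pairwise fun s t => t.2.1 ≤ s.1)
    (hinc : ∀ s ∈ s₀ :: L, Increment G Ψ η s.1 s.2.1 s.2.2)
    (f : StrongDual ℝ X) (hf : ‖f‖ ≤ 1) :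
    (L.map fun s => |f s.2.2| ^ q).sum + 2 ^ q * |f s₀.2.2| ^ q ≤
      C * ‖f‖ ^ q + (2 - 2 * (1 / 2) ^ s₀.1) := by
  have h22 : (2 : ℝ) ^ q * 2 ^ q = 4 ^ q := by
    rw [← Real.mul_rpow (by norm_num) (by norm_num)]; norm_num
  have h24 : (2 : ℝ) ^ q * 4 ^ q = 8 ^ q := by
    rw [← Real.mul_rpow (by norm_num) (by norm_num)]; norm_num
  have h48 : (4 : ℝ) ^ q ≤ 8 ^ q := Real.rpow_le_rpow (by norm_num) (by norm_num) hq.le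
  have hv2 : ∀ s : ℕ × ℕ × X, Increment G Ψ η s.1 s.2.1 s.2.2 → ‖s.2.2‖ ≤ 2 := by
    rintro s ⟨-, ⟨y, hy, z, hz, h⟩, -⟩
    rw [h]
    exact (norm_sub_le _ _).trans (by linarith [hG1 _ y hy, hG1 _ z hz])
  have happ : ∀ (g : StrongDual ℝ X) (s : ℕ × ℕ × X), Increment G Ψ η s.1 s.2.1 s.2.2 →
      |g s.2.2| ≤ 2 * ‖g‖ := fun g s hs => by
    have h1 := g.le_opNorm s.2.2
    have h2 := mul_le_mul_of_nonneg_left (hv2 s hs) (ContinuousLinearMap.opNorm_nonneg g)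
    rw [Real.norm_eq_abs] at h1
    linarith
  have happq : ∀ (g : StrongDual ℝ X) (s : ℕ × ℕ × X), Increment G Ψ η s.1 s.2.1 s.2.2 →
      |g s.2.2| ^ q ≤ 2 ^ q * ‖g‖ ^ q := fun g s hs => by
    rw [← Real.mul_rpow (by norm_num) (ContinuousLinearMap.opNorm_nonneg g)]
    exact Real.rpow_le_rpow (abs_nonneg _) (happ g s hs) hq.le
  induction L generalizing s₀ f with
  | nil =>
    have h1 := happq f s₀ (hinc s₀ List.mem_cons_self)
    have h2 : (2 : ℝ) ^ q * |f s₀.2.2| ^ q ≤ 4 ^ q * ‖f‖ ^ q := by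
      rw [← h22, mul_assoc]
      exact mul_le_mul_of_nonneg_left h1 (by positivity)
    have h3 : (1 / 2 : ℝ) ^ s₀.1 ≤ 1 := pow_le_one₀ (by norm_num) (by norm_num)
    have h4 := mul_le_mul_of_nonneg_right hC4
      (Real.rpow_nonneg (ContinuousLinearMap.opNorm_nonneg f) q)
    simp only [List.map_nil, List.sum_nil]
    linarith
  | cons s₁ L ih =>
    rw [List.pairwise_cons] at hL
    have hL1 := List.pairwise_cons.1 hL.2
    have hi0 := hinc s₀ List.mem_cons_self
    have hi1 := hinc s₁ (List.mem_cons_of_mem _ List.mem_cons_self)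
    have h10 : s₁.2.1 ≤ s₀.1 := hL.1 s₁ List.mem_cons_self
    obtain ⟨j, hj⟩ : ∃ j, s₀.1 = j + 1 := ⟨s₀.1 - 1, by have := hi1.1; omega⟩
    have h1j : s₁.1 ≤ j := by have := hi1.1; omega
    obtain ⟨S, hSΨ, hS1, hSc, hSG⟩ := hΨ j f hf
    have hIH := ih s₁ hL.2 (fun s hs => hinc s (List.mem_cons_of_mem _ hs)) S hS1
    set g := f - S with hg
    have hfg : ∀ v, f v = S v + g v := fun v => by rw [hg, sub_apply]; ring
    have hgn : 0 ≤ ‖g‖ ^ q := Real.rpow_nonneg (ContinuousLinearMap.opNorm_nonneg g) q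
    have hold : (L.map fun s => |f s.2.2| ^ q).sum ≤
        (L.map fun s => |S s.2.2| ^ q).sum + κ j * (j + 1) := by
      have hlen : (L.length : ℝ) ≤ j + 1 := by
        have := length_le_of_pairwise L s₁.1 hL1.2 (fun s hs => (hinc s
          (List.mem_cons_of_mem _ (List.mem_cons_of_mem _ hs))).1) hL1.1
        exact_mod_cast this.trans (h1j.trans j.le_succ)
      have h1 : (L.map fun s => |f s.2.2| ^ q).sum ≤ (L.map fun s => |S s.2.2| ^ q + κ j).sum := by
        refine List.sum_le_sum fun s hs => ?_
        have hi := hinc s (List.mem_cons_of_mem _ (List.mem_cons_of_mem _ hs))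
        refine hκ j _ _ (abs_nonneg _) ((happ f s hi).trans (by linarith)) (abs_nonneg _)
          ((happ S s hi).trans (by linarith)) ?_
        have hgs : |g s.2.2| ≤ 2 * η j := by
          obtain ⟨hlt, ⟨y, hy, z, hz, h⟩, -⟩ := hi
          have hsj : s.2.1 ≤ j := (hL1.1 s hs).trans h1j
          have hy' := hSG y (hGm (hlt.le.trans hsj) hy)
          have hz' := hSG z (hGm hsj hz)
          rw [h, map_sub]
          exact (abs_sub _ _).trans (by linarith)
        rw [hfg]
        exact (abs_add_le _ _).trans (by linarith)
      have h2 : (L.map fun s => |S s.2.2| ^ q + κ j).sum =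
          (L.map fun s => |S s.2.2| ^ q).sum + L.length * κ j := by
        simp [List.sum_map_add]
      have h3 := mul_le_mul_of_nonneg_right hlen (hκ0 j)
      linarith
    have hmid : |f s₁.2.2| ^ q ≤ 2 ^ q * |S s₁.2.2| ^ q + 4 ^ q * ‖g‖ ^ q := by
      have h1 : |f s₁.2.2| ^ q ≤ (|S s₁.2.2| + |g s₁.2.2|) ^ q := by
        rw [hfg]
        exact Real.rpow_le_rpow (abs_nonneg _) (abs_add_le _ _) hq.le
      have h2 := add_rpow_le_two (abs_nonneg (S s₁.2.2)) (abs_nonneg (g s₁.2.2)) hq.le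
      have h3 := mul_le_mul_of_nonneg_left (happq g s₁ hi1)
        (Real.rpow_nonneg zero_le_two q)
      rw [← mul_assoc, h22] at h3
      linarith
    have hnew : 2 ^ q * |f s₀.2.2| ^ q ≤ 4 ^ q * κ j + 8 ^ q * ‖g‖ ^ q := by
      have h1 : |f s₀.2.2| ^ q ≤ (|S s₀.2.2| + |g s₀.2.2|) ^ q := by
        rw [hfg]
        exact Real.rpow_le_rpow (abs_nonneg _) (abs_add_le _ _) hq.le
      have h2 := add_rpow_le_two (abs_nonneg (S s₀.2.2)) (abs_nonneg (g s₀.2.2)) hq.le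
      have h3 : |S s₀.2.2| ^ q ≤ κ j := by
        have hS0 : |S s₀.2.2| ≤ 2 * η j := by
          have := hi0.2.2 S (by rw [hj]; exact hSΨ)
          rwa [hj, Nat.add_sub_cancel] at this
        have := hκ j _ 0 (abs_nonneg (S s₀.2.2)) (hS0.trans (by linarith [hη j])) le_rfl
          zero_le_two (by linarith)
        rwa [Real.zero_rpow hq.ne', zero_add] at this
      have h4 := happq g s₀ hi0
      calc 2 ^ q * |f s₀.2.2| ^ q ≤ 2 ^ q * (2 ^ q * (κ j + 2 ^ q * ‖g‖ ^ q)) :=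
            mul_le_mul_of_nonneg_left ((h1.trans h2).trans (mul_le_mul_of_nonneg_left
              (add_le_add h3 h4) (by positivity))) (by positivity)
        _ = (2 ^ q * 2 ^ q) * κ j + 2 ^ q * (2 ^ q * 2 ^ q) * ‖g‖ ^ q := by ring
        _ = _ := by rw [h22, h24]
    have hSc' := mul_le_mul_of_nonneg_left hSc hC0
    have hC' := mul_le_mul_of_nonneg_right hC hgn
    have h48' := mul_le_mul_of_nonneg_right h48 hgn
    have hpow : (1 / 2 : ℝ) ^ s₀.1 = (1 / 2) ^ j / 2 := by rw [hj, pow_succ]; ring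
    have hpow1 : (1 / 2 : ℝ) ^ j ≤ (1 / 2) ^ s₁.1 :=
      pow_le_pow_of_le_one (by norm_num) (by norm_num) h1j
    have := hsum j
    rw [List.map_cons, List.sum_cons, hpow]
    linarith

lemma exists_increments (hq : 0 < q) {G : ℕ → Finset X} {Ψ : ℕ → Finset (StrongDual ℝ X)}
    {η : ℕ → ℝ} {N : ℕ → ℕ} (hN : Monotone N) (S : (ℕ → ℕ) → ℕ → X)
    (hS : ∀ a m n, m ≤ n → S a n - S a m = 0 ∨
      ∃ e ≤ N n, Increment G Ψ η (N m) e (S a n - S a m)) (l : List Seg) (hl : IsChain l) :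
    ∃ L : List (ℕ × ℕ × X), (L.Pairwise fun s t => t.2.1 ≤ s.1) ∧
      (∀ s ∈ L, Increment G Ψ η s.1 s.2.1 s.2.2) ∧ (∀ s ∈ L, ∃ t ∈ l, s.2.1 ≤ N t.2.2) ∧
      ∀ f : StrongDual ℝ X, chainSum q (fun a n => f (S a n)) l =
        (L.map fun s => |f s.2.2| ^ q).sum := by
  induction l with
  | nil => exact ⟨[], List.Pairwise.nil, by simp, by simp, fun f => by simp [chainSum]⟩
  | cons s l ih =>
    obtain ⟨hp, hle⟩ := hl
    rw [List.pairwise_cons] at hp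
    obtain ⟨L, h1, h2, h3, h4⟩ := ih ⟨hp.2, fun t ht => hle t (List.mem_cons_of_mem _ ht)⟩
    have hcs : ∀ f : StrongDual ℝ X, chainSum q (fun a n => f (S a n)) (s :: l) =
        |f (S s.1 s.2.2 - S s.1 s.2.1)| ^ q + (L.map fun s => |f s.2.2| ^ q).sum := fun f => by
      rw [← h4, map_sub]
      simp [chainSum]
    rcases hS s.1 s.2.1 s.2.2 (hle s List.mem_cons_self) with h | ⟨e, he, h⟩
    · refine ⟨L, h1, h2, fun t ht => ?_, fun f => ?_⟩
      · obtain ⟨r, hr, htr⟩ := h3 t ht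
        exact ⟨r, List.mem_cons_of_mem _ hr, htr⟩
      · rw [hcs, h, map_zero, abs_zero, Real.zero_rpow hq.ne', zero_add]
    · refine ⟨(N s.2.1, e, S s.1 s.2.2 - S s.1 s.2.1) :: L,
        List.pairwise_cons.2 ⟨fun t ht => ?_, h1⟩, ?_, ?_, fun f => ?_⟩
      · obtain ⟨r, hr, htr⟩ := h3 t ht
        exact htr.trans (hN (hp.1 r hr))
      · exact List.forall_mem_cons.2 ⟨h, h2⟩
      · refine List.forall_mem_cons.2 ⟨⟨s, List.mem_cons_self, he⟩, fun t ht => ?_⟩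
        obtain ⟨r, hr, htr⟩ := h3 t ht
        exact ⟨r, List.mem_cons_of_mem _ hr, htr⟩
      · rw [hcs, List.map_cons, List.sum_cons]

lemma isQuotientOf_of_weakStarLower [CompleteSpace X] [TopologicalSpace.SeparableSpace X]
    (hq : 0 < q) (hX : WeakStarLower q X) : IsQuotientOf X (ChainSpace hq) := by
  obtain ⟨c, hc, hcX⟩ := hX
  set C : ℝ := max (2 * 8 ^ q / c) (4 ^ q) with hC
  have h4 : (1 : ℝ) ≤ 4 ^ q := Real.one_le_rpow (by norm_num) hq.le
  have hC4 : 4 ^ q ≤ C := le_max_right _ _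
  have hC0 : 0 < C := by linarith
  have hCc : 2 * 8 ^ q ≤ C * c := by
    rw [← div_le_iff₀ hc]; exact le_max_left _ _
  let ε : ℕ → ℝ := fun j => (1 / 2) ^ j / (3 * C)
  let κ : ℕ → ℝ := fun j => (1 / 2) ^ j / (3 * 4 ^ q * (j + 1))
  have hε : ∀ j, 0 < ε j := fun j => by positivity
  have hκ0 : ∀ j, 0 < κ j := fun j => by positivity
  have hsum : ∀ j, C * ε j + κ j * (j + 1) + 4 ^ q * κ j ≤ (1 / 2) ^ j := by
    intro j
    have hj : (0 : ℝ) < (1 / 2) ^ j := by positivity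
    have e1 : C * ε j = (1 / 2) ^ j / 3 := by simp only [ε]; field_simp
    have e2 : κ j * (j + 1) ≤ (1 / 2) ^ j / 3 := by
      have : κ j * (j + 1) = (1 / 2) ^ j / (3 * 4 ^ q) := by simp only [κ]; field_simp
      rw [this]
      exact div_le_div_of_nonneg_left hj.le (by norm_num) (by linarith)
    have e3 : 4 ^ q * κ j ≤ (1 / 2) ^ j / 3 := by
      have : 4 ^ q * κ j = (1 / 2) ^ j / (3 * (j + 1)) := by simp only [κ]; field_simp
      rw [this]
      refine div_le_div_of_nonneg_left hj.le (by norm_num) ?_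
      have : (0 : ℝ) ≤ j := j.cast_nonneg
      linarith
    linarith
  have hδ : ∀ j, ∃ δ > 0, ∀ s t, 0 ≤ s → s ≤ 2 → 0 ≤ t → t ≤ 2 → s ≤ t + δ → s ^ q ≤ t ^ q + κ j :=
    fun j => exists_rpow_uniform hq 2 (hκ0 j)
  choose δ hδ0 hδ using hδ
  obtain ⟨η, hηanti, hη⟩ := exists_antitone_le (fun j => min (δ j / 2) 1)
    fun j => lt_min (half_pos (hδ0 j)) one_pos
  have hη1 : ∀ j, 0 < η j ∧ η j ≤ 1 := fun j => ⟨(hη j).1, (hη j).2.trans (min_le_right _ _)⟩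
  have hηκ : ∀ j s t, 0 ≤ s → s ≤ 2 → 0 ≤ t → t ≤ 2 → s ≤ t + 2 * η j → s ^ q ≤ t ^ q + κ j := by
    intro j s t h1 h2 h3 h4 h5
    have := (hη j).2.trans (min_le_left _ _)
    exact hδ j s t h1 h2 h3 h4 (by linarith)
  have : Nonempty (closedBall (0 : X) 1) := ⟨⟨0, by simp⟩⟩
  let x : ℕ → X := fun n => TopologicalSpace.denseSeq (closedBall (0 : X) 1) n
  have hx : ∀ n, ‖x n‖ ≤ 1 := fun n => mem_closedBall_zero_iff.1 (Subtype.prop _)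
  obtain ⟨G, Ψ, hG0, hΨ0, hGm, hΨm, hG1, hΨ, hnet, hxG⟩ :=
    exists_nets hcX ε η hε (fun j => (hη j).1) x hx
  obtain ⟨N, dec, hN, hN0, hNu, hdec⟩ := exists_levels G hG0
  let d : (ℕ → ℕ) → ℕ → X := fun a n => Nat.casesOn n 0 fun j => dec j (a j)
  let alive : (ℕ → ℕ) → ℕ → Prop := fun a n => (∀ k ≤ n, d a k ∈ G (N k)) ∧
    ∀ k ≤ n, ∀ i < k, (N i = N k → d a k = d a i) ∧
      ∀ φ ∈ Ψ (N i), |φ (d a k - d a i)| ≤ 2 * η (N i - 1)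
  have hd : ∀ a b n, (∀ i < n, a i = b i) → d a n = d b n := by
    intro a b n h
    cases n with
    | zero => rfl
    | succ n => change dec _ _ = dec _ _; rw [h n n.lt_succ_self]
  have halive : ∀ a b n, (∀ i < n, a i = b i) → alive a n → alive b n := by
    rintro a b n h ⟨h1, h2⟩
    have hd' : ∀ j ≤ n, d b j = d a j := fun j hj =>
      hd b a j fun i hi => (h i (hi.trans_le hj)).symm
    refine ⟨fun k hk => hd' k hk ▸ h1 k hk, fun k hk i hi => ?_⟩
    rw [hd' k hk, hd' i (hi.le.trans hk)]
    exact h2 k hk i hi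
  have hmono : ∀ a m n, m ≤ n → alive a n → alive a m := fun a m n h hn =>
    ⟨fun j hj => hn.1 j (hj.trans h), fun j hj => hn.2 j (hj.trans h)⟩
  have h0 : ∀ a, alive a 0 := by
    refine fun a => ⟨fun j hj => ?_, fun j hj i hi => ?_⟩
    · rw [Nat.le_zero.1 hj, hN0, hG0]
      exact Finset.mem_singleton_self _
    · omega
  let S : (ℕ → ℕ) → ℕ → X := fun a n => d a (lastTrue (alive a) n)
  have hSinc : ∀ a m n, m ≤ n → S a n - S a m = 0 ∨
      ∃ e ≤ N n, Increment G Ψ η (N m) e (S a n - S a m) := by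
    intro a m n h
    rcases lastTrue_eq_or (h0 a) (hmono a) h with h1 | ⟨h1, h2⟩
    · left
      simp only [S, h1, sub_self]
    · have hj := lastTrue_spec (h0 a) (hmono a) n
      have hjn := lastTrue_le (A := alive a) n
      simp only [S, h1]
      set j := lastTrue (alive a) n
      have h3 := hj.2 j le_rfl m h2
      rcases (hN h2.le).eq_or_lt with he | he
      · left
        rw [h3.1 he, sub_self]
      · exact Or.inr ⟨N j, hN hjn, he, ⟨_, hj.1 m h2.le, _, hj.1 j le_rfl, rfl⟩, h3.2⟩
  refine isQuotientOf_chainSpace hq S (fun a => ?_) (fun a b n h => ?_) (M := C + 2)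
    (fun f hf l hl => ?_) fun y hy => ?_
  · have : lastTrue (alive a) 0 = 0 := Nat.le_zero.1 (lastTrue_le 0)
    simp only [S, this]
    rfl
  · have : lastTrue (alive a) n = lastTrue (alive b) n := lastTrue_congr fun m hm =>
      ⟨halive a b m fun i hi => h i (hi.trans_le hm),
        halive b a m fun i hi => (h i (hi.trans_le hm)).symm⟩
    simp only [S, this]
    exact hd a b _ fun i hi => h i (hi.trans_le (lastTrue_le n))
  · obtain ⟨L, h1, h2, -, h3⟩ := exists_increments hq hN S hSinc l hl
    rw [h3]
    cases L with
    | nil => simp only [List.map_nil, List.sum_nil]; linarith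
    | cons s L =>
      have h5 := sum_increments_le hq hGm hG1 hΨ hη1 hηκ hsum (fun j => (hκ0 j).le) hC0.le hCc hC4
        L s h1 h2 f hf
      have h6 : |f s.2.2| ^ q ≤ 2 ^ q * |f s.2.2| ^ q :=
        le_mul_of_one_le_left (by positivity) (Real.one_le_rpow (by norm_num) hq.le)
      have h7 : ‖f‖ ^ q ≤ 1 :=
        Real.rpow_le_one (ContinuousLinearMap.opNorm_nonneg f) hf hq.le
      have h8 : (0 : ℝ) ≤ (1 / 2) ^ s.1 := by positivity
      rw [List.map_cons, List.sum_cons]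
      nlinarith
  · obtain ⟨l, hl⟩ : ∃ l, ‖y - x l‖ ≤ 1 / 2 := by
      obtain ⟨_, ⟨l, rfl⟩, hl⟩ := Metric.mem_closure_iff.1
        (TopologicalSpace.denseRange_denseSeq (closedBall (0 : X) 1)
          ⟨y, mem_closedBall_zero_iff.2 hy⟩) (1 / 2) (by norm_num)
      rw [Subtype.dist_eq, dist_eq_norm] at hl
      exact ⟨l, hl.le⟩
    have hz : ∀ j, ∃ z ∈ G j, (∀ φ ∈ Ψ j, |φ (x l - z)| ≤ η (j - 1)) ∧ (l + 1 ≤ j → z = x l) := by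
      intro j
      rcases lt_or_ge j (l + 1) with h | h
      · cases j with
        | zero => exact ⟨0, by simp [hG0], by simp [hΨ0], fun h => by omega⟩
        | succ j =>
          obtain ⟨z, h1, h2⟩ := hnet j (x l) (hx l)
          exact ⟨z, h1, h2, fun h => by omega⟩
      · refine ⟨x l, hGm h (hxG l), fun φ _ => ?_, fun _ => rfl⟩
        rw [sub_self, map_zero, abs_zero]
        exact (hη _).1.le
    choose z hzG hzΨ hzl using hz
    have ha : ∀ n, ∃ k ≤ n, dec n k = z (N (n + 1)) := fun n => hdec n _ (hzG _)
    choose a han had using ha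
    have hda : ∀ n, d a n = z (N n) := by
      intro n
      cases n with
      | zero =>
        have := hzG 0
        rw [hG0, Finset.mem_singleton] at this
        rw [hN0, this]; rfl
      | succ n => exact had n
    have hal : ∀ n, alive a n := by
      refine fun n => ⟨fun k _ => by rw [hda]; exact hzG _, fun k _ i hi => ?_⟩
      rw [hda k, hda i]
      refine ⟨fun h => by rw [h], fun φ hφ => ?_⟩
      have h1 := hzΨ _ φ hφ
      have h2 := hzΨ _ φ (hΨm (hN hi.le) hφ)
      have h3 : η (N k - 1) ≤ η (N i - 1) := hηanti (Nat.sub_le_sub_right (hN hi.le) 1)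
      have h4 : φ (z (N k) - z (N i)) = φ (x l - z (N i)) - φ (x l - z (N k)) := by
        rw [← map_sub]; congr 1; abel
      rw [h4]
      exact (abs_sub _ _).trans (by linarith)
    obtain ⟨n, hn⟩ := hNu (l + 1)
    refine ⟨a, n, han, ?_⟩
    simp only [S, lastTrue_eq_self (hal n), hda, hzl _ hn]
    exact hl

end

lemma WeakUpper.prod {p : ℝ} (hp : 0 < p) {X Y : Type*} [NormedAddCommGroup X] [NormedSpace ℝ X]
    [NormedAddCommGroup Y] [NormedSpace ℝ Y] (hX : WeakUpper p X) (hY : WeakUpper p Y) :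
    WeakUpper p (X × Y) := by
  obtain ⟨C, hC, hX⟩ := hX
  obtain ⟨D, hD, hY⟩ := hY
  refine ⟨C + D, by positivity, fun y R ε hε => ?_⟩
  filter_upwards
    [(tendsto_weakZero (ContinuousLinearMap.fst ℝ X Y)).eventually (hX y.1 R ε hε),
      (tendsto_weakZero (ContinuousLinearMap.snd ℝ X Y)).eventually (hY y.2 R ε hε)]
    with z h1 h2 hz
  have h1 := h1 ((norm_fst_le z).trans hz)
  have h2 := h2 ((norm_snd_le z).trans hz)
  have a1 := Real.rpow_le_rpow (norm_nonneg _) (norm_fst_le y) hp.le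
  have a2 := Real.rpow_le_rpow (norm_nonneg _) (norm_snd_le y) hp.le
  have b1 := Real.rpow_le_rpow (norm_nonneg _) (norm_fst_le z) hp.le
  have b2 := Real.rpow_le_rpow (norm_nonneg _) (norm_snd_le z) hp.le
  have b0 := Real.rpow_nonneg (norm_nonneg z) p
  have c1 := mul_le_mul_of_nonneg_left b1 hC.le
  have c2 := mul_le_mul_of_nonneg_left b2 hD.le
  have hC0 := mul_nonneg hC.le b0
  have hD0 := mul_nonneg hD.le b0
  change ‖(y + z).1‖ ^ p ≤ ‖y.1‖ ^ p + C * ‖z.1‖ ^ p + ε at h1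
  change ‖(y + z).2‖ ^ p ≤ ‖y.2‖ ^ p + D * ‖z.2‖ ^ p + ε at h2
  rw [add_mul]
  rcases max_choice ‖(y + z).1‖ ‖(y + z).2‖ with h | h <;> rw [Prod.norm_def, h] <;> linarith

/-- A space isomorphic to one with a weak* lower estimate. -/
lemma exists_weakStarLower_of_pAUSable {p q : ℝ} (hpq : p.HolderConjugate q) {X : Type u}
    [NormedAddCommGroup X] [NormedSpace ℝ X] (h : PAUSable p X) :
    ∃ (X' : Type u) (_ : NormedAddCommGroup X') (_ : NormedSpace ℝ X'),
      Nonempty (X ≃L[ℝ] X') ∧ WeakStarLower q X' := by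
  obtain ⟨N, hN, hNp⟩ := h
  obtain ⟨X', i1, i2, e, he⟩ := exists_renorming hN
  exact ⟨X', i1, i2, ⟨e⟩,
    ((subspaceUpper_of_renorming hN.1 hNp e he).weakUpper hpq.lt).weakStarLower hpq⟩

end PAUS

open PAUS

/-- For every `p ∈ (1,∞)` there exists a separable Banach space `U` admitting an equivalent
`p`-AUS norm such that for every separable Banach space `X`:
`X` admits an equivalent `p`-AUS norm ↔ `X` is isomorphic to a closed subspace of `U`
↔ `X` is a quotient of `U`. -/
theorem pAUS_iff_subspace_iff_quotient_of_universal (p : ℝ) (hp : 1 < p) :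
    ∃ (U : Type) (_ : NormedAddCommGroup U) (_ : NormedSpace ℝ U) (_ : CompleteSpace U),
      TopologicalSpace.SeparableSpace U ∧ PAUSable p U ∧
      ∀ (X : Type u) (_ : NormedAddCommGroup X) (_ : NormedSpace ℝ X) (_ : CompleteSpace X),
        TopologicalSpace.SeparableSpace X →
          ((PAUSable p X ↔ IsomToClosedSubspace X U) ∧
            (PAUSable p X ↔ IsQuotientOf X U)) := by
  obtain ⟨q, hpq⟩ : ∃ q : ℝ, p.HolderConjugate q := ⟨_, Real.HolderConjugate.conjExponent hp⟩
  have hq1 := hpq.symm.lt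
  have hq : 0 < q := by linarith
  have := separableSpace_chainSpace hq
  have := separableSpace_branchSpace (q := q) labelWt_pos
  have hU := ((weakUpper_chainSpace hpq hq).prod hpq.pos
    (weakUpper_branchSpace hpq labelWt_pos)).weakStarLower hpq
  refine ⟨ChainSpace hq × BranchSpace labelWt q, inferInstance, inferInstance, inferInstance,
    inferInstance, pAUSable_of_weakStarLower hpq hU (ContinuousLinearMap.id ℝ _) one_pos
      fun y => by simp, fun X _ _ _ hXs => ⟨⟨fun h => ?_, ?_⟩, ⟨fun h => ?_, ?_⟩⟩⟩
  · obtain ⟨X', _, _, ⟨e⟩, hX'⟩ := exists_weakStarLower_of_pAUSable hpq h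
    have : TopologicalSpace.SeparableSpace X' :=
      e.surjective.denseRange.separableSpace e.continuous
    obtain ⟨T, hT, c, hc, hTc⟩ := isomToClosedSubspace_of_weakStarLower hq1 hX'
    refine ⟨(ContinuousLinearMap.inr ℝ _ _).comp (T.comp e.toContinuousLinearMap),
      fun x y hxy => e.injective (hT (Prod.mk.inj hxy).2),
      c / (‖e.symm.toContinuousLinearMap‖ + 1), by positivity, fun y => ?_⟩
    have h1 := e.symm.toContinuousLinearMap.le_opNorm (e y)
    have h2 : e.symm.toContinuousLinearMap (e y) = y := e.symm_apply_apply y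
    rw [h2] at h1
    have h3 : ‖y‖ ≤ (‖e.symm.toContinuousLinearMap‖ + 1) * ‖e y‖ := by
      linarith [norm_nonneg (e y)]
    calc c / (‖e.symm.toContinuousLinearMap‖ + 1) * ‖y‖ ≤ c * ‖e y‖ := by
          rw [div_mul_eq_mul_div, div_le_iff₀ (by positivity), mul_assoc]
          exact mul_le_mul_of_nonneg_left (by linarith) hc.le
      _ ≤ ‖T (e y)‖ := hTc _
      _ ≤ _ := norm_snd_le ((0, T (e y)) : ChainSpace hq × BranchSpace labelWt q)
  · rintro ⟨T, -, c, hc, hT⟩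
    exact pAUSable_of_weakStarLower hpq hU T hc hT
  · obtain ⟨X', _, _, ⟨e⟩, hX'⟩ := exists_weakStarLower_of_pAUSable hpq h
    have : TopologicalSpace.SeparableSpace X' :=
      e.surjective.denseRange.separableSpace e.continuous
    have : CompleteSpace X' :=
      (completeSpace_congr (e := e.toEquiv) e.isUniformEmbedding).1 inferInstance
    obtain ⟨Q, hQ⟩ := isQuotientOf_of_weakStarLower hq hX'
    refine ⟨e.symm.toContinuousLinearMap.comp (Q.comp (ContinuousLinearMap.fst ℝ _ _)), ?_⟩
    exact e.symm.surjective.comp (hQ.comp Prod.fst_surjective)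
  · rintro ⟨Q, hQ⟩
    exact pAUSable_of_quotient hpq hU Q hQ
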